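/- arXiv:2205.07296 — 4 statements merged into one kernel-verified Lean document; each statement's English description precedes it below -/
import Mathlib

section
/- There exist absolute constants c > 0 and C > 0 with the following property. Let G be an abelian group, l a positive integer, and Λ ⊆ G a finite l-dissociated set with |Λ| ≥ 2. Then C·|Λ|·log|Λ| ≥ dim(Σ_{|Λ|}(Λ)) ≥ c·min{|Λ|·log|Λ|, l}. -/
open Finset Pointwise

universe u

/-- A finset `Λ` in an abelian group is `k`-dissociated if every integer relation
`∑ ε_λ • λ = 0` with `|ε_λ| ≤ k` forces all `ε_λ = 0`. -/
def IsKDissociated {G : Type*} [AddCommGroup G] (k : ℕ) (Λ : Finset G) : Prop :=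
  ∀ ε : G → ℤ, (∀ x ∈ Λ, |ε x| ≤ (k : ℤ)) → (∑ x ∈ Λ, ε x • x) = 0 → ∀ x ∈ Λ, ε x = 0

/-- `addDim k A` is the maximal size of a `k`-dissociated subset of `A`. -/
noncomputable def addDim {G : Type*} [AddCommGroup G] (k : ℕ) (A : Finset G) : ℕ :=
  sSup {n : ℕ | ∃ Λ : Finset G, Λ ⊆ A ∧ Λ.card = n ∧ IsKDissociated k Λ}

/-- `nFold A n` is the `n`-fold sumset `A + A + ⋯ + A` (`n` summands). -/
def nFold {G : Type*} [AddCommGroup G] [DecidableEq G] (A : Finset G) : ℕ → Finset G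
  | 0 => {0}
  | n + 1 => nFold A n + A

/-- `sigmaSum k A` is the set of all sums `∑_{s ∈ S} s` over subsets `S ⊆ A` with `|S| ≤ k`. -/
def sigmaSum {G : Type*} [AddCommGroup G] [DecidableEq G] (k : ℕ) (A : Finset G) : Finset G :=
  (A.powerset.filter (fun S => S.card ≤ k)).image (fun S => ∑ x ∈ S, x)

/-- The recursive construction of a detecting matrix with entries in `{-1,0,1}`. -/
theorem exists_detecting (k : ℕ) : ∃ (ι κ : Type) (_ : Fintype ι) (_ : Fintype κ)
    (A : κ → ι → ℤ), Fintype.card ι = 2 ^ k ∧ 2 * Fintype.card κ = 2 ^ k * (k + 2) ∧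
      (∀ j i, A j i = 0 ∨ A j i = 1 ∨ A j i = -1) ∧
      ∀ ε : κ → ℤ, (∀ j, |ε j| ≤ 1) → (∀ i, ∑ j, ε j * A j i = 0) → ∀ j, ε j = 0 := by
  classical
  induction k with
  | zero =>
    refine ⟨Unit, Unit, inferInstance, inferInstance, fun _ _ => 1, by simp, by simp, by simp, ?_⟩
    intro ε _ h j
    simpa using h ()
  | succ k ih =>
    obtain ⟨ι, κ, _, _, A, h1, h2, h3, h4⟩ := ih
    refine ⟨ι ⊕ ι, (κ ⊕ κ) ⊕ ι, inferInstance, inferInstance,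
      Sum.elim (Sum.elim (fun j => Sum.elim (A j) (A j)) (fun j => Sum.elim (A j) (fun i => - A j i)))
        (fun i => Sum.elim (fun i' => if i = i' then 1 else 0) (fun _ => 0)), ?_, ?_, ?_, ?_⟩
    · simp [h1, pow_succ]; ring
    · simp only [Fintype.card_sum, h1]
      rw [mul_add, mul_add, h2]; ring
    · rintro ((j | j) | i) (i' | i')
      · simpa using h3 j i'
      · simpa using h3 j i'
      · simpa using h3 j i'
      · rcases h3 j i' with h | h | h <;> simp [h]
      · by_cases h : i = i' <;> simp [h]
      · simp
    · intro ε hε h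
      have hz : ∀ i, ε (Sum.inr i) = 0 ∧ ∑ j, ε (Sum.inl (Sum.inl j)) * A j i = 0 ∧
          ∑ j, ε (Sum.inl (Sum.inr j)) * A j i = 0 := by
        intro i
        have e1 := h (Sum.inl i)
        have e2 := h (Sum.inr i)
        simp [Fintype.sum_sum_type] at e1 e2
        have := abs_le.mp (hε (Sum.inr i))
        omega
      have hx := h4 (fun j => ε (Sum.inl (Sum.inl j))) (fun j => hε _) (fun i => (hz i).2.1)
      have hy := h4 (fun j => ε (Sum.inl (Sum.inr j))) (fun j => hε _) (fun i => (hz i).2.2)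
      rintro ((j | j) | i)
      · exact hx j
      · exact hy j
      · exact (hz i).1

/-- The `{0,1}` version, as a family of finsets. -/
theorem exists_detecting_sets (k : ℕ) : ∃ (ι κ : Type) (_ : Fintype ι) (_ : Fintype κ)
    (_ : DecidableEq ι) (B : κ → Finset ι), Fintype.card ι = 2 ^ (k + 1) ∧
      2 * Fintype.card κ = 2 ^ k * (k + 2) ∧
      ∀ ε : κ → ℤ, (∀ j, |ε j| ≤ 1) → (∀ i, ∑ j, (if i ∈ B j then ε j else 0) = 0) →
        ∀ j, ε j = 0 := by
  classical
  obtain ⟨ι, κ, _, _, A, h1, h2, h3, h4⟩ := exists_detecting k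
  refine ⟨ι ⊕ ι, κ, inferInstance, inferInstance, inferInstance,
    fun j => Finset.univ.filter (fun i => Sum.elim (fun i => A j i = 1) (fun i => A j i = -1) i),
    ?_, h2, ?_⟩
  · simp [h1, pow_succ]; ring
  · intro ε hε h
    refine h4 ε hε ?_
    intro i
    have e1 := h (Sum.inl i)
    have e2 := h (Sum.inr i)
    refine Eq.trans ?_ ((congrArg₂ (· - ·) e1 e2).trans (sub_zero 0))
    simp only
    rw [← Finset.sum_sub_distrib]
    refine Finset.sum_congr rfl fun j _ => ?_
    rcases h3 j i with h | h | h <;> simp [h]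

theorem addDim_bdd {G : Type*} [AddCommGroup G] (k : ℕ) (A : Finset G) :
    BddAbove {n : ℕ | ∃ Λ : Finset G, Λ ⊆ A ∧ Λ.card = n ∧ IsKDissociated k Λ} := by
  refine ⟨A.card, ?_⟩
  rintro n ⟨D, hD, rfl, _⟩
  exact Finset.card_le_card hD

theorem addDim_spec {G : Type*} [AddCommGroup G] (k : ℕ) (A : Finset G) :
    ∃ D : Finset G, D ⊆ A ∧ D.card = addDim k A ∧ IsKDissociated k D := by
  have := Nat.sSup_mem (s := {n : ℕ | ∃ Λ : Finset G, Λ ⊆ A ∧ Λ.card = n ∧ IsKDissociated k Λ})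
    ⟨0, ∅, by simp, by simp, by intro ε; simp⟩ (addDim_bdd k A)
  exact this

theorem le_addDim {G : Type*} [AddCommGroup G] (k : ℕ) (A D : Finset G) (h : D ⊆ A)
    (hD : IsKDissociated k D) : D.card ≤ addDim k A :=
  le_csSup (addDim_bdd k A) ⟨D, h, rfl, hD⟩

theorem two_pow_le {G : Type*} [AddCommGroup G] [DecidableEq G] (Λ D : Finset G) (k : ℕ)
    (h : D ⊆ sigmaSum k Λ) (hD : IsKDissociated 1 D) :
    2 ^ D.card ≤ (D.card + 1) ^ Λ.card := by
  classical
  have hS : ∀ d ∈ D, ∃ S : Finset G, S ⊆ Λ ∧ ∑ x ∈ S, x = d := by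
    intro d hd
    have := h hd
    simp only [sigmaSum, Finset.mem_image, Finset.mem_filter, Finset.mem_powerset] at this
    obtain ⟨S, ⟨h1, _⟩, h2⟩ := this
    exact ⟨S, h1, h2⟩
  choose! S hS1 hS2 using hS
  have key : ∀ T ⊆ D, ∑ d ∈ T, d = ∑ x ∈ Λ, (T.filter (fun d => x ∈ S d)).card • x := by
    intro T hT
    calc ∑ d ∈ T, d = ∑ d ∈ T, ∑ x ∈ Λ, if x ∈ S d then x else 0 := by
          refine Finset.sum_congr rfl fun d hd => ?_
          rw [← Finset.sum_filter, Finset.filter_mem_eq_inter,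
            Finset.inter_eq_right.mpr (hS1 d (hT hd)), hS2 d (hT hd)]
      _ = _ := by
          rw [Finset.sum_comm]
          refine Finset.sum_congr rfl fun x _ => ?_
          rw [← Finset.sum_filter, Finset.sum_const]
  have hcard : D.powerset.card ≤
      (Fintype.piFinset (fun _ : Λ => Finset.range (D.card + 1))).card := by
    refine Finset.card_le_card_of_injOn
      (fun T => fun x : Λ => (T.filter (fun d => x.1 ∈ S d)).card) ?_ ?_
    · intro T hT
      have hT : T ⊆ D := by simpa using hT
      simp only [Finset.mem_coe, Fintype.mem_piFinset, Finset.mem_range]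
      intro x
      exact Nat.lt_succ_of_le ((Finset.card_filter_le _ _).trans (Finset.card_le_card hT))
    · intro T hT T' hT' e
      have hT : T ⊆ D := by simpa using hT
      have hT' : T' ⊆ D := by simpa using hT'
      have es : ∑ d ∈ T, d = ∑ d ∈ T', d := by
        rw [key T hT, key T' hT']
        refine Finset.sum_congr rfl fun x hx => ?_
        have := congrFun e ⟨x, hx⟩
        simp only at this
        rw [this]
      have := hD (fun d => (if d ∈ T then 1 else 0) - (if d ∈ T' then 1 else 0)) ?_ ?_
      · ext d
        constructor
        · intro hd
          have := this d (hT hd)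
          by_contra h'
          simp [hd, h'] at this
        · intro hd
          have := this d (hT' hd)
          by_contra h'
          simp [hd, h'] at this
      · intro d _
        by_cases h1 : d ∈ T <;> by_cases h2 : d ∈ T' <;> simp [h1, h2]
      · simp only [sub_smul, Finset.sum_sub_distrib, ite_smul, one_smul, zero_smul]
        rw [← Finset.sum_filter, ← Finset.sum_filter, Finset.filter_mem_eq_inter,
          Finset.filter_mem_eq_inter, Finset.inter_eq_right.mpr hT,
          Finset.inter_eq_right.mpr hT', es, sub_self]
  simpa using hcard

theorem upper_real (m n : ℕ) (hn : 2 ≤ n) (h : 2 ^ m ≤ (m + 1) ^ n) :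
    (m : ℝ) ≤ 7 * n * Real.logb 2 n := by
  have hn' : (2 : ℝ) ≤ n := by exact_mod_cast hn
  have h' : (2 : ℝ) ^ m ≤ ((m : ℝ) + 1) ^ n := by exact_mod_cast h
  have hm0 : (0 : ℝ) ≤ m := by positivity
  have hL : 1 ≤ Real.logb 2 n := by
    rw [Real.le_logb_iff_rpow_le (by norm_num) (by linarith)]; simpa using hn'
  have h1 : (m : ℝ) ≤ n * Real.logb 2 (m + 1) := by
    have := Real.logb_le_logb_of_le (b := 2) (by norm_num) (by positivity) h'
    rw [Real.logb_pow, Real.logb_pow, Real.logb_self_eq_one (by norm_num)] at this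
    simpa using this
  have h2 : Real.logb 2 ((m + 1) / (n : ℝ) ^ 3) ≤ 2 * ((m + 1) / (n : ℝ) ^ 3) := by
    have hy : (0 : ℝ) < (m + 1) / (n : ℝ) ^ 3 := by positivity
    set y := (m + 1) / (n : ℝ) ^ 3
    have hl2 := Real.log_two_gt_d9
    rw [Real.logb, div_le_iff₀ (by linarith)]
    have := Real.log_le_sub_one_of_pos hy
    nlinarith
  rw [Real.logb_div (by positivity) (by positivity), Real.logb_pow] at h2
  have h3 : (n : ℝ) * (2 * ((m + 1) / (n : ℝ) ^ 3)) ≤ (m + 1) / 2 := by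
    have : (n : ℝ) * (2 * ((m + 1) / (n : ℝ) ^ 3)) = 2 * (m + 1) / (n : ℝ) ^ 2 := by
      field_simp
    rw [this, div_le_div_iff₀ (by positivity) (by norm_num)]
    have h4 : (4 : ℝ) ≤ (n : ℝ) ^ 2 := by nlinarith
    have := mul_le_mul_of_nonneg_left h4 (by positivity : (0 : ℝ) ≤ m + 1)
    linarith
  push_cast at h2
  have h4 : (n : ℝ) * Real.logb 2 (m + 1) ≤
      n * (3 * Real.logb 2 n + 2 * ((m + 1) / (n : ℝ) ^ 3)) := by
    apply mul_le_mul_of_nonneg_left _ (by linarith)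
    linarith
  nlinarith

theorem lower_comb {G : Type*} [AddCommGroup G] [DecidableEq G] (l k : ℕ) (Λ : Finset G)
    (hk : 2 ^ (k + 1) ≤ Λ.card) (hΛ : IsKDissociated l Λ) :
    ∃ m : ℕ, 2 * m = 2 ^ k * (k + 2) ∧ min m l ≤ addDim 1 (sigmaSum Λ.card Λ) := by
  classical
  obtain ⟨ι, κ, _, _, _, B, h1, h2, h3⟩ := exists_detecting_sets k
  refine ⟨Fintype.card κ, h2, ?_⟩
  obtain ⟨f⟩ : Nonempty (ι ↪ Λ) := by
    apply Function.Embedding.nonempty_of_card_le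
    simpa [h1] using hk
  let g : ι ↪ G := f.trans (Function.Embedding.subtype _)
  have hg : ∀ i, g i ∈ Λ := fun i => (f i).2
  let s : κ → G := fun j => ∑ x ∈ (B j).map g, x
  obtain ⟨K, -, hK⟩ := Finset.exists_subset_card_eq (s := (Finset.univ : Finset κ))
    (n := min (Fintype.card κ) l) (by simp)
  have key : ∀ δ : κ → ℤ, (∀ j, |δ j| ≤ 1) → ∑ j ∈ K, δ j • s j = 0 → ∀ j ∈ K, δ j = 0 := by
    intro δ hδ hsum
    have hsub : ∀ j, (B j).map g ⊆ Λ := by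
      intro j x hx
      obtain ⟨i, _, rfl⟩ := Finset.mem_map.mp hx
      exact hg i
    have e : ∑ j ∈ K, δ j • s j =
        ∑ x ∈ Λ, (∑ j ∈ K, if x ∈ (B j).map g then δ j else 0) • x := by
      simp only [Finset.sum_smul]
      rw [Finset.sum_comm]
      refine Finset.sum_congr rfl fun j _ => ?_
      simp only [ite_smul, zero_smul]
      rw [← Finset.sum_filter, Finset.filter_mem_eq_inter, Finset.inter_eq_right.mpr (hsub j),
        ← Finset.smul_sum]
    have hz := hΛ (fun x => ∑ j ∈ K, if x ∈ (B j).map g then δ j else 0) ?_ (by rw [← e]; exact hsum)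
    · have := h3 (fun j => if j ∈ K then δ j else 0) ?_ ?_
      · intro j hj
        simpa [hj] using this j
      · intro j
        by_cases hj : j ∈ K
        · simpa [hj] using hδ j
        · simp [hj]
      · intro i
        have h := hz (g i) (hg i)
        simp only [Finset.mem_map', ← Finset.sum_filter] at h ⊢
        rw [← h]
        refine Finset.sum_congr ?_ fun _ _ => rfl
        ext j; simp [and_comm]
    · intro x _
      refine (Finset.abs_sum_le_sum_abs _ _).trans ?_
      have : ∑ j ∈ K, |if x ∈ (B j).map g then δ j else 0| ≤ ∑ j ∈ K, (1 : ℤ) := by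
        refine Finset.sum_le_sum fun j _ => ?_
        split_ifs
        · exact hδ j
        · simp
      refine this.trans ?_
      simp [hK]
  have hinj : Set.InjOn s K := by
    intro a ha b hb hab
    by_contra hne
    have := key (fun j => (if j = a then 1 else 0) - (if j = b then 1 else 0)) ?_ ?_ a ha
    · simp [hne] at this
    · intro j
      by_cases h1 : j = a <;> by_cases h2 : j = b <;> simp [h1, h2] <;> split_ifs <;> simp
    · have ha : a ∈ K := ha
      have hb : b ∈ K := hb
      simp [sub_smul, Finset.sum_sub_distrib, ite_smul, ha, hb, hab]
  rw [← hK, ← Finset.card_image_of_injOn hinj]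
  apply le_addDim
  · intro y hy
    obtain ⟨j, _, rfl⟩ := Finset.mem_image.mp hy
    have hsub : (B j).map g ⊆ Λ := by
      intro x hx
      obtain ⟨i, _, rfl⟩ := Finset.mem_map.mp hx
      exact hg i
    simp only [sigmaSum, Finset.mem_image, Finset.mem_filter, Finset.mem_powerset]
    exact ⟨_, ⟨hsub, Finset.card_le_card hsub⟩, rfl⟩
  · intro ε hε hs y hy
    rw [Finset.sum_image hinj] at hs
    have := key (fun j => if j ∈ K then ε (s j) else 0) ?_ ?_
    · obtain ⟨j, hj, rfl⟩ := Finset.mem_image.mp hy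
      simpa [hj] using this j hj
    · intro j
      by_cases hj : j ∈ K
      · simpa [hj] using hε (s j) (Finset.mem_image_of_mem _ hj)
      · simp [hj]
    · rw [← hs]
      refine Finset.sum_congr rfl fun j hj => ?_
      simp [hj]

theorem stmt5 :
    ∃ c C : ℝ, 0 < c ∧ 0 < C ∧
      ∀ (G : Type u) [AddCommGroup G] [DecidableEq G] (l : ℕ) (Λ : Finset G),
        1 ≤ l → 2 ≤ Λ.card → IsKDissociated l Λ →
        C * Λ.card * Real.logb 2 Λ.card ≥ (addDim 1 (sigmaSum Λ.card Λ) : ℝ) ∧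
        (addDim 1 (sigmaSum Λ.card Λ) : ℝ) ≥
          c * min ((Λ.card : ℝ) * Real.logb 2 Λ.card) (l : ℝ) := by
  refine ⟨1 / 8, 7, by norm_num, by norm_num, ?_⟩
  intro G _ _ l Λ hl hn hΛ
  constructor
  · obtain ⟨D, h1, h2, h3⟩ := addDim_spec 1 (sigmaSum Λ.card Λ)
    rw [← h2]
    exact upper_real _ _ hn (two_pow_le Λ D _ h1 h3)
  · have hlog : 1 ≤ Nat.log 2 Λ.card := Nat.log_pos (by norm_num) hn
    obtain ⟨k, hk⟩ : ∃ k, Nat.log 2 Λ.card = k + 1 := ⟨_, (Nat.sub_add_cancel hlog).symm⟩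
    have hk1 : 2 ^ (k + 1) ≤ Λ.card := by
      rw [← hk]; exact Nat.pow_log_le_self 2 (by omega)
    have hk2 : Λ.card < 2 ^ (k + 2) := by
      have := Nat.lt_pow_succ_log_self (b := 2) (by norm_num) Λ.card
      rwa [hk] at this
    obtain ⟨m, hm, hle⟩ := lower_comb l k Λ hk1 hΛ
    have hle' : min (m : ℝ) (l : ℝ) ≤ (addDim 1 (sigmaSum Λ.card Λ) : ℝ) := by
      exact_mod_cast hle
    refine le_trans ?_ hle'
    have hn' : (2 : ℝ) ≤ Λ.card := by exact_mod_cast hn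
    have hm' : 2 * (m : ℝ) = 2 ^ k * (k + 2) := by exact_mod_cast hm
    have hk2' : (Λ.card : ℝ) ≤ 2 ^ (k + 2) := by exact_mod_cast hk2.le
    have hL : Real.logb 2 Λ.card ≤ k + 2 := by
      rw [Real.logb_le_iff_le_rpow (by norm_num) (by linarith)]
      exact_mod_cast hk2'
    have hL0 : 0 ≤ Real.logb 2 Λ.card := Real.logb_nonneg (by norm_num) (by linarith)
    have hprod : (Λ.card : ℝ) * Real.logb 2 Λ.card ≤ 2 ^ (k + 2) * (k + 2) :=
      mul_le_mul hk2' hL hL0 (by positivity)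
    have h8 : (Λ.card : ℝ) * Real.logb 2 Λ.card ≤ 8 * m := by
      rw [pow_add] at hprod
      nlinarith
    have hl0 : (0 : ℝ) ≤ l := by positivity
    apply le_min
    · have := min_le_left ((Λ.card : ℝ) * Real.logb 2 Λ.card) (l : ℝ)
      linarith
    · have := min_le_right ((Λ.card : ℝ) * Real.logb 2 Λ.card) (l : ℝ)
      linarith
end

section
/- There exist absolute constants c > 0 and C* > 0 with the following property. Let G be an abelian group and A ⊆ G a finite set with |A| ≥ 2; write d = dim(A) and M = d/log|A|, and suppose M ≥ 4. Then there exists an integer m with c·log|A|/log M ≤ m ≤ d/2 such that T_m(A) ≥ |A|^{2m} / ( 2d·4^m·e^d·binom(d+1, 2m) ) ≥ |A|^{2m} / |A|^{C*·M}. -/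
open Finset Pointwise

universe u

/-- `Tk k A` counts tuples `(a₁,…,a_k,a_{k+1},…,a_{2k}) ∈ A^{2k}` with
`a₁ + ⋯ + a_k = a_{k+1} + ⋯ + a_{2k}`. -/
noncomputable def Tk {G : Type*} [AddCommGroup G] (k : ℕ) (A : Finset G) : ℕ :=
  Set.ncard {f : (Fin k → G) × (Fin k → G) |
    (∀ i, f.1 i ∈ A) ∧ (∀ i, f.2 i ∈ A) ∧ ∑ i, f.1 i = ∑ i, f.2 i}

open Classical in
lemma card_pairs_eq {α G : Type*} (P : Finset α) (V : Finset G) (f g : α → G)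
    (hV : ∀ a ∈ P, f a ∈ V) :
    #{p ∈ P ×ˢ P | f p.1 = g p.2} = ∑ v ∈ V, #{a ∈ P | f a = v} * #{a ∈ P | g a = v} := by
  rw [Finset.card_eq_sum_card_fiberwise (f := fun p => f p.1) (t := V)]
  · refine Finset.sum_congr rfl fun v _ => ?_
    rw [← Finset.card_product]
    congr 1
    ext ⟨a, b⟩
    simp only [Finset.mem_filter, Finset.mem_product]
    constructor
    · rintro ⟨⟨⟨h1, h2⟩, h3⟩, h4⟩
      exact ⟨⟨h1, h4⟩, h2, h3 ▸ h4⟩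
    · rintro ⟨⟨h1, h2⟩, h3, h4⟩
      exact ⟨⟨⟨h1, h3⟩, h2.trans h4.symm⟩, h2⟩
  · intro p hp
    simp only [Finset.coe_filter, Finset.mem_product, Set.mem_ofPred_eq] at hp
    exact hV _ hp.1.1

open Classical in
lemma two_mul_card_pairs_le {α G : Type*} (P : Finset α) (f g : α → G) :
    2 * #{p ∈ P ×ˢ P | f p.1 = g p.2} ≤
      #{p ∈ P ×ˢ P | f p.1 = f p.2} + #{p ∈ P ×ˢ P | g p.1 = g p.2} := by
  have hf : ∀ a ∈ P, f a ∈ P.image f ∪ P.image g := fun a ha =>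
    Finset.mem_union_left _ (Finset.mem_image_of_mem _ ha)
  have hg : ∀ a ∈ P, g a ∈ P.image f ∪ P.image g := fun a ha =>
    Finset.mem_union_right _ (Finset.mem_image_of_mem _ ha)
  rw [card_pairs_eq P _ f g hf, card_pairs_eq P _ f f hf, card_pairs_eq P _ g g hg,
    Finset.mul_sum, ← Finset.sum_add_distrib]
  refine Finset.sum_le_sum fun v _ => ?_
  zify
  nlinarith [sq_nonneg ((#{a ∈ P | f a = v} : ℤ) - #{a ∈ P | g a = v})]

open Classical in
lemma Tk_eq_card {G : Type*} [AddCommGroup G] (m : ℕ) (A : Finset G) :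
    Tk m A = #{p ∈ (Fintype.piFinset fun _ : Fin m => A) ×ˢ (Fintype.piFinset fun _ : Fin m => A) |
      ∑ i, p.1 i = ∑ i, p.2 i} := by
  unfold Tk
  rw [← Set.ncard_coe_finset]
  congr 1
  ext p
  simp [Fintype.mem_piFinset, and_assoc]

open Classical in
lemma energy_le {G : Type*} [AddCommGroup G] (m : ℕ) (A : Finset G) (ε : Fin m → ℤ)
    (hε : ∀ i, ε i = 1 ∨ ε i = -1) :
    #{p ∈ (Fintype.piFinset fun _ : Fin m => A) ×ˢ (Fintype.piFinset fun _ : Fin m => A) |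
      ∑ i, ε i • p.1 i = ∑ i, ε i • p.2 i} ≤ Tk m A := by
  rw [Tk_eq_card]
  refine Finset.card_le_card_of_injOn
    (fun p => (fun i => if ε i = 1 then p.1 i else p.2 i,
      fun i => if ε i = 1 then p.2 i else p.1 i)) ?_ ?_
  · intro p hp
    simp only [Finset.coe_filter, Finset.mem_product, Set.mem_ofPred_eq,
      Fintype.mem_piFinset] at hp ⊢
    obtain ⟨⟨h1, h2⟩, h3⟩ := hp
    refine ⟨⟨fun i => ?_, fun i => ?_⟩, ?_⟩
    · split_ifs <;> simp [h1, h2]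
    · split_ifs <;> simp [h1, h2]
    · rw [← sub_eq_zero, ← Finset.sum_sub_distrib] at h3 ⊢
      rw [← h3]
      refine Finset.sum_congr rfl fun i _ => ?_
      rcases hε i with h | h <;> simp [h]
      abel
  · rintro ⟨a, b⟩ _ ⟨a', b'⟩ _ h
    simp only [Prod.mk.injEq, funext_iff] at h ⊢
    obtain ⟨h1, h2⟩ := h
    constructor <;> intro i <;> have := h1 i <;> have := h2 i <;> by_cases hi : ε i = 1 <;> simp_all

open Classical in
lemma card_two_le {G : Type*} [AddCommGroup G] (m : ℕ) (A : Finset G) (ε δ : Fin m → ℤ)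
    (hε : ∀ i, ε i = 1 ∨ ε i = -1) (hδ : ∀ i, δ i = 1 ∨ δ i = -1) (w : G) :
    #{p ∈ (Fintype.piFinset fun _ : Fin m => A) ×ˢ (Fintype.piFinset fun _ : Fin m => A) |
      ∑ i, ε i • p.1 i = w - ∑ i, δ i • p.2 i} ≤ Tk m A := by
  have h := two_mul_card_pairs_le (Fintype.piFinset fun _ : Fin m => A)
    (fun a => ∑ i, ε i • a i) (fun b => w - ∑ i, δ i • b i)
  have h1 := energy_le m A ε hε
  have h2 := energy_le m A δ hδ
  simp only [sub_right_inj] at h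
  omega

/-- Solutions in `A` of the linear equation with coefficients `ε`. -/
noncomputable def solSet {G : Type*} [AddCommGroup G] {n : ℕ} (A : Finset G) (ε : Fin n → ℤ) :
    Finset (Fin n → G) :=
  open Classical in {a ∈ Fintype.piFinset fun _ : Fin n => A | ∑ i, ε i • a i = 0}

lemma mem_solSet {G : Type*} [AddCommGroup G] {n : ℕ} {A : Finset G} {ε : Fin n → ℤ}
    {a : Fin n → G} : a ∈ solSet A ε ↔ (∀ i, a i ∈ A) ∧ ∑ i, ε i • a i = 0 := by
  simp [solSet]

/-- Sign patterns. -/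
def signs (n : ℕ) : Finset (Fin n → ℤ) := Fintype.piFinset fun _ => {-1, 0, 1}

/-- Support of a sign pattern. -/
def spt {n : ℕ} (ε : Fin n → ℤ) : Finset (Fin n) := {i | ε i ≠ 0}

lemma signs_cases {n : ℕ} {ε : Fin n → ℤ} (h : ε ∈ signs n) (i : Fin n) (hi : ε i ≠ 0) :
    ε i = 1 ∨ ε i = -1 := by
  have := Fintype.mem_piFinset.1 h i
  simp at this
  tauto

open Classical in
lemma solSet_mul_le {G : Type*} [AddCommGroup G] {n : ℕ} (A : Finset G) {ε : Fin n → ℤ}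
    (hε : ε ∈ signs n) (i : Fin n) (hi : ε i ≠ 0) :
    #(solSet A ε) * #A ≤ #A ^ n := by
  have hc : #(Fintype.piFinset fun _ : Fin n => A) = #A ^ n := by simp
  rw [← hc, ← Finset.card_product]
  refine Finset.card_le_card_of_injOn (fun p => Function.update p.1 i p.2) ?_ ?_
  · rintro ⟨a, x⟩ h
    simp only [Finset.coe_product, Set.mem_prod, Finset.mem_coe, mem_solSet] at h
    simp only [Finset.mem_coe, Fintype.mem_piFinset]
    intro j
    by_cases hj : j = i
    · subst hj; simpa using h.2
    · simpa [hj] using h.1.1 j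
  · rintro ⟨a, x⟩ h ⟨b, y⟩ h' e
    simp only [Finset.coe_product, Set.mem_prod, Finset.mem_coe, mem_solSet] at h h'
    simp only at e
    have hxy : x = y := by simpa using congrFun e i
    have hab : ∀ j, j ≠ i → a j = b j := fun j hj => by simpa [hj] using congrFun e j
    have hs : ∑ j, ε j • (a j - b j) = 0 := by
      simp only [smul_sub, Finset.sum_sub_distrib, h.1.2, h'.1.2, sub_zero]
    rw [Finset.sum_eq_single i] at hs
    · have : a i = b i := by
        rcases signs_cases hε i hi with h1 | h1 <;> rw [h1] at hs
        · simpa [sub_eq_zero] using hs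
        · simp [sub_eq_zero] at hs
          exact hs.symm
      refine Prod.ext ?_ hxy
      funext j
      by_cases hj : j = i
      · rw [hj]; exact this
      · exact hab j hj
    · intro j _ hj
      rw [hab j hj]; simp
    · simp

open Classical in
lemma solSet_le_Tk {G : Type*} [AddCommGroup G] {n : ℕ} (A : Finset G) {ε : Fin n → ℤ}
    (hε : ε ∈ signs n) (m : ℕ) (hm : 2 * m ≤ #(spt ε)) :
    #(solSet A ε) * #A ^ (2 * m) ≤ Tk m A * #A ^ n := by
  have hmn : 2 * m ≤ n := hm.trans ((Finset.card_le_univ _).trans (by simp))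
  obtain ⟨g0⟩ : Nonempty (Fin m ⊕ Fin m ↪ spt ε) := by
    apply Function.Embedding.nonempty_of_card_le
    simp only [Fintype.card_sum, Fintype.card_fin, Fintype.card_coe]
    omega
  set g : Fin m ⊕ Fin m → Fin n := fun x => (g0 x : Fin n) with hg
  have hginj : Function.Injective g := fun x y h => g0.injective (Subtype.ext h)
  have hgs : ∀ x, ε (g x) = 1 ∨ ε (g x) = -1 := fun x => by
    apply signs_cases hε
    exact (Finset.mem_filter.1 (g0 x).2).2
  set I : Finset (Fin n) := univ.image g with hI
  have hIc : #I = 2 * m := by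
    rw [hI, Finset.card_image_of_injective _ hginj]
    simp; omega
  let res : (Fin n → G) → ({i // i ∉ I} → G) := fun a i => a i
  have key : #(solSet A ε) ≤ Tk m A * #((solSet A ε).image res) := by
    refine Finset.card_le_mul_card_image _ _ fun c hc => ?_
    obtain ⟨c0, hc0, rfl⟩ := Finset.mem_image.1 hc
    refine le_trans ?_ (card_two_le m A (fun j => ε (g (.inl j))) (fun j => ε (g (.inr j)))
      (fun j => hgs _) (fun j => hgs _) (-∑ i ∈ Iᶜ, ε i • c0 i))
    refine Finset.card_le_card_of_injOn
      (fun a => (fun j => a (g (.inl j)), fun j => a (g (.inr j)))) ?_ ?_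
    · intro a ha
      simp only [Finset.coe_filter, Set.mem_ofPred_eq, mem_solSet] at ha
      simp only [Finset.coe_filter, Set.mem_ofPred_eq, Finset.mem_product, Fintype.mem_piFinset]
      obtain ⟨⟨h1, h2⟩, h3⟩ := ha
      refine ⟨⟨fun j => h1 _, fun j => h1 _⟩, ?_⟩
      have h4 : ∑ i ∈ Iᶜ, ε i • c0 i = ∑ i ∈ Iᶜ, ε i • a i := by
        refine Finset.sum_congr rfl fun i hi => ?_
        have := congrFun h3 ⟨i, Finset.mem_compl.1 hi⟩
        simp only [res] at this
        rw [this]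
      have h5 : ∑ i ∈ I, ε i • a i = ∑ j, ε (g (.inl j)) • a (g (.inl j)) +
          ∑ j, ε (g (.inr j)) • a (g (.inr j)) := by
        rw [hI, Finset.sum_image (fun x _ y _ h => hginj h), Fintype.sum_sum_type]
      rw [← Finset.sum_add_sum_compl I, h5, ← h4] at h2
      rw [eq_sub_iff_add_eq, eq_neg_iff_add_eq_zero]
      exact h2
    · intro a ha b hb h
      simp only [Finset.coe_filter, Set.mem_ofPred_eq] at ha hb
      simp only [Prod.mk.injEq] at h
      funext i
      by_cases hi : i ∈ I
      · obtain ⟨x, -, rfl⟩ := Finset.mem_image.1 hi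
        rcases x with x | x
        · exact congrFun h.1 x
        · exact congrFun h.2 x
      · exact congrFun (ha.2.trans hb.2.symm) ⟨i, hi⟩
  have him : #((solSet A ε).image res) ≤ #A ^ (n - 2 * m) := by
    have : #(Fintype.piFinset fun _ : {i // i ∉ I} => A) = #A ^ (n - 2 * m) := by
      rw [Fintype.card_piFinset]
      simp [hIc, Fintype.card_subtype_compl]
    rw [← this]
    apply Finset.card_le_card
    intro c hc
    obtain ⟨a, ha, rfl⟩ := Finset.mem_image.1 hc
    rw [Fintype.mem_piFinset]
    exact fun i => (mem_solSet.1 ha).1 _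
  calc #(solSet A ε) * #A ^ (2 * m) ≤ Tk m A * #A ^ (n - 2 * m) * #A ^ (2 * m) := by
        gcongr
        exact key.trans (by gcongr)
    _ = Tk m A * #A ^ n := by
        rw [mul_assoc, ← pow_add]; congr 2; omega

open Classical in
lemma exists_relation {G : Type*} [AddCommGroup G] (A : Finset G) (a : Fin (addDim 1 A + 1) → G)
    (ha : ∀ i, a i ∈ A) : ∃ ε ∈ signs (addDim 1 A + 1), (∃ i, ε i ≠ 0) ∧ a ∈ solSet A ε := by
  by_cases hinj : Function.Injective a
  · have hnot : ¬ IsKDissociated 1 (univ.image a) := by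
      intro h
      have : addDim 1 A + 1 ≤ addDim 1 A := by
        apply le_csSup
        · refine ⟨#A, ?_⟩
          rintro n ⟨L, hL, rfl, -⟩
          exact Finset.card_le_card hL
        · refine ⟨univ.image a, ?_, ?_, h⟩
          · intro x hx
            obtain ⟨i, -, rfl⟩ := Finset.mem_image.1 hx
            exact ha i
          · rw [Finset.card_image_of_injective _ hinj]; simp
      omega
    unfold IsKDissociated at hnot
    push Not at hnot
    obtain ⟨e, h1, h2, x, hx, hx0⟩ := hnot
    obtain ⟨i, -, rfl⟩ := Finset.mem_image.1 hx
    refine ⟨fun j => e (a j), ?_, ⟨i, hx0⟩, mem_solSet.2 ⟨ha, ?_⟩⟩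
    · rw [signs, Fintype.mem_piFinset]
      intro j
      have := h1 (a j) (Finset.mem_image_of_mem _ (Finset.mem_univ _))
      rw [abs_le] at this
      simp only [Finset.mem_insert, Finset.mem_singleton]
      push_cast at this
      omega
    · rw [Finset.sum_image (fun x _ y _ h => hinj h)] at h2
      exact h2
  · simp only [Function.Injective] at hinj
    push Not at hinj
    obtain ⟨i, j, hij, hne⟩ := hinj
    refine ⟨fun k => (if k = i then 1 else 0) - (if k = j then 1 else 0), ?_, ⟨i, ?_⟩,
      mem_solSet.2 ⟨ha, ?_⟩⟩
    · rw [signs, Fintype.mem_piFinset]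
      intro k
      split_ifs <;> simp
    · simp [hne]
    · simp [sub_smul, Finset.sum_sub_distrib, ite_smul, hij]

open Classical in
lemma pow_le_sum {G : Type*} [AddCommGroup G] (A : Finset G) :
    #A ^ (addDim 1 A + 1) ≤ ∑ ε ∈ (signs (addDim 1 A + 1)).filter (fun ε => ∃ i, ε i ≠ 0),
      #(solSet A ε) := by
  have hc : #(Fintype.piFinset fun _ : Fin (addDim 1 A + 1) => A) = #A ^ (addDim 1 A + 1) := by simp
  rw [← hc]
  refine le_trans (Finset.card_le_card ?_) Finset.card_biUnion_le
  intro a ha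
  obtain ⟨ε, h1, h2, h3⟩ := exists_relation A a (Fintype.mem_piFinset.1 ha)
  exact Finset.mem_biUnion.2 ⟨ε, Finset.mem_filter.2 ⟨h1, h2⟩, h3⟩

open Classical in
lemma card_signs_spt (n s : ℕ) : #{ε ∈ signs n | #(spt ε) = s} ≤ 2 ^ s * n.choose s := by
  have h := Finset.card_le_mul_card_image (f := spt) {ε ∈ signs n | #(spt ε) = s} (2 ^ s) ?_
  · refine h.trans ?_
    gcongr
    have : n.choose s = #(Finset.powersetCard s (univ : Finset (Fin n))) := by simp
    rw [this]
    apply Finset.card_le_card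
    intro T hT
    obtain ⟨e, he, rfl⟩ := Finset.mem_image.1 hT
    exact Finset.mem_powersetCard.2 ⟨Finset.subset_univ _, (Finset.mem_filter.1 he).2⟩
  · intro T hT
    obtain ⟨e, he, rfl⟩ := Finset.mem_image.1 hT
    have hs := (Finset.mem_filter.1 he).2
    set T := spt e
    have : #(Fintype.piFinset fun i : Fin n => if i ∈ T then ({-1, 1} : Finset ℤ) else {0}) = 2 ^ s := by
      rw [Fintype.card_piFinset]
      have : ∀ i : Fin n, #(if i ∈ T then ({-1, 1} : Finset ℤ) else {0}) = if i ∈ T then 2 else 1 := by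
        intro i; split_ifs <;> rfl
      simp only [this]
      rw [Finset.prod_ite]
      simp [hs]
    rw [← this]
    apply Finset.card_le_card
    intro δ hδ
    simp only [Finset.mem_filter] at hδ
    rw [Fintype.mem_piFinset]
    intro i
    have h1 := signs_cases hδ.1.1 i
    by_cases hi : i ∈ T
    · have : i ∈ spt δ := hδ.2 ▸ hi
      simp only [spt, Finset.mem_filter] at this
      simp only [hi, if_true, Finset.mem_insert, Finset.mem_singleton]
      exact (h1 this.2).symm
    · have : i ∉ spt δ := hδ.2 ▸ hi
      simp [spt] at this
      simp [hi, this]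

lemma sum_signs_pow (n : ℕ) (y : ℝ) : ∑ ε ∈ signs n, y ^ #(spt ε) = (1 + 2 * y) ^ n := by
  have h : ∀ ε : Fin n → ℤ, y ^ #(spt ε) = ∏ i, (if ε i ≠ 0 then y else 1) := by
    intro ε
    rw [Finset.prod_ite]
    simp [spt]
  simp only [h]
  rw [signs, ← Finset.prod_univ_sum (fun _ : Fin n => ({-1, 0, 1} : Finset ℤ))
    (fun _ x => if x ≠ 0 then y else 1)]
  simp
  ring

lemma exp_bound (d : ℕ) (hd : 4 ≤ d) : 4 * ((d : ℝ) + 1) ^ 2 < d * Real.exp d := by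
  have h1 : 4 * ((d : ℝ) + 1) ^ 2 < d * (5 / 2 : ℝ) ^ d := by
    induction d, hd using Nat.le_induction with
    | base => norm_num
    | succ k hk ih =>
      have hk' : (4 : ℝ) ≤ k := by exact_mod_cast hk
      have hp : (0 : ℝ) < (5 / 2 : ℝ) ^ k := by positivity
      push_cast
      have e : ((k : ℝ) + 1) * (5 / 2 : ℝ) ^ (k + 1) =
          5 / 2 * (k * (5 / 2 : ℝ) ^ k) + 5 / 2 * (5 / 2 : ℝ) ^ k := by ring
      rw [e]
      nlinarith
  refine h1.trans_le ?_
  have : Real.exp d = Real.exp 1 ^ d := by rw [← Real.exp_nat_mul]; simp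
  rw [this]
  gcongr
  linarith [Real.exp_one_gt_d9]

open Classical in
lemma pow_le_Tk {G : Type*} [AddCommGroup G] (m : ℕ) (A : Finset G) : #A ^ m ≤ Tk m A := by
  have hc : #(Fintype.piFinset fun _ : Fin m => A) = #A ^ m := by simp
  rw [Tk_eq_card, ← hc]
  refine Finset.card_le_card_of_injOn (fun a => (a, a)) ?_ ?_
  · intro a ha
    simpa using ha
  · intro a _ b _ h
    exact (Prod.mk.inj h).1

lemma short_count (d : ℕ) (L M K : ℝ) (hd : 4 ≤ d) (hM : 4 ≤ M) (hL : 2 ≤ L)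
    (hdM : (d : ℝ) = M * L) (hK : K = L / (12 * Real.logb 2 M)) :
    (#{ε ∈ signs (d + 1) | (#(spt ε) : ℝ) < K} : ℝ) ≤ (2 : ℝ) ^ L / 2 := by
  have hd' : (4 : ℝ) ≤ d := by exact_mod_cast hd
  have hlog : 0 < Real.logb 2 M := Real.logb_pos (by norm_num) (by linarith)
  have hK0 : 0 ≤ K := by rw [hK]; positivity
  set y : ℝ := 1 / (16 * M) with hy
  have hy0 : 0 < y := by positivity
  have hy1 : y ≤ 1 := by
    rw [hy, div_le_one (by positivity)]; linarith
  have h1 : (#{ε ∈ signs (d + 1) | (#(spt ε) : ℝ) < K} : ℝ) * y ^ K ≤ (1 + 2 * y) ^ (d + 1) := by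
    rw [← sum_signs_pow, ← nsmul_eq_mul, ← Finset.sum_const]
    refine (Finset.sum_le_sum (g := fun ε => y ^ #(spt ε)) fun ε hε => ?_).trans
      (Finset.sum_le_sum_of_subset_of_nonneg (Finset.filter_subset _ _) fun _ _ _ => by positivity)
    rw [← Real.rpow_natCast]
    exact Real.rpow_le_rpow_of_exponent_ge hy0 hy1 (Finset.mem_filter.1 hε).2.le
  have h2 : (1 + 2 * y) ^ (d + 1) ≤ (2 : ℝ) ^ (L / 4) := by
    have e1 : (1 + 2 * y) ^ (d + 1) ≤ Real.exp (2 * y) ^ (d + 1) := by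
      gcongr
      linarith [Real.add_one_le_exp (2 * y)]
    refine e1.trans ?_
    rw [← Real.exp_nat_mul, Real.rpow_def_of_pos (by norm_num)]
    apply Real.exp_le_exp.2
    have e2 : ((d + 1 : ℕ) : ℝ) * (2 * y) ≤ 5 / 32 * L := by
      have : 5 / 32 * L = (5 / 4 * d) * (2 * y) := by
        rw [hdM, hy]; field_simp; norm_num
      rw [this]
      push_cast
      gcongr
      linarith
    have := Real.log_two_gt_d9
    nlinarith
  have h3 : (y ^ K)⁻¹ ≤ (2 : ℝ) ^ (L / 4) := by
    have e1 : (y ^ K)⁻¹ = (16 * M) ^ K := by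
      rw [← Real.inv_rpow hy0.le, hy, one_div, inv_inv]
    have e2 : (16 * M) ^ K ≤ (M ^ (3 : ℝ)) ^ K := by
      apply Real.rpow_le_rpow (by positivity) _ hK0
      have : M ^ (3 : ℝ) = M ^ 3 := by exact_mod_cast Real.rpow_natCast M 3
      rw [this]
      nlinarith [mul_le_mul hM hM (by norm_num) (by linarith)]
    have e3 : (M ^ (3 : ℝ)) ^ K = (2 : ℝ) ^ (L / 4) := by
      rw [← Real.rpow_mul (by linarith)]
      have : M = 2 ^ Real.logb 2 M := (Real.rpow_logb (by norm_num) (by norm_num) (by linarith)).symm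
      conv_lhs => rw [this]
      rw [← Real.rpow_mul (by norm_num), hK]
      congr 1
      field_simp
      norm_num
    rw [e1]; exact e2.trans e3.le
  have hyK : 0 < y ^ K := Real.rpow_pos_of_pos hy0 _
  have h4 : (#{ε ∈ signs (d + 1) | (#(spt ε) : ℝ) < K} : ℝ) ≤ (2 : ℝ) ^ (L / 4) * 2 ^ (L / 4) := by
    calc (#{ε ∈ signs (d + 1) | (#(spt ε) : ℝ) < K} : ℝ)
        ≤ (1 + 2 * y) ^ (d + 1) * (y ^ K)⁻¹ := by
          rw [← div_eq_mul_inv, le_div_iff₀ hyK]; exact h1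
      _ ≤ _ := mul_le_mul h2 h3 (by positivity) (by positivity)
  refine h4.trans ?_
  rw [← Real.rpow_add (by norm_num)]
  have : (2 : ℝ) ^ L / 2 = 2 ^ (L - 1) := by
    rw [Real.rpow_sub (by norm_num)]; simp
  rw [this]
  apply Real.rpow_le_rpow_of_exponent_le (by norm_num)
  linarith

lemma choose_bound (d s m : ℕ) (hd : 4 ≤ d) (hs : s ≤ d + 1) (hm : m = min (s / 2) (d / 2)) :
    2 ^ s * (d + 1).choose s ≤ 4 * 4 ^ m * ((d + 1) * (d + 1).choose (2 * m)) := by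
  have h2m : 2 * m ≤ d := by omega
  have hpos : 1 ≤ (d + 1).choose (2 * m) := Nat.choose_pos (by omega)
  have h1 : 2 ^ s ≤ 4 * 4 ^ m := by
    have : 4 * 4 ^ m = 2 ^ (2 * m + 2) := by rw [pow_add, pow_mul]; norm_num; ring
    rw [this]
    exact Nat.pow_le_pow_right (by norm_num) (by omega)
  refine Nat.mul_le_mul h1 ?_
  have hcase : s = 2 * m ∨ s = 2 * m + 1 ∨ s = d + 1 := by omega
  rcases hcase with h | h | h
  · rw [h]; nlinarith
  · rw [h]
    have e := Nat.choose_succ_right_eq (d + 1) (2 * m)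
    calc (d + 1).choose (2 * m + 1) ≤ (d + 1).choose (2 * m + 1) * (2 * m + 1) :=
          Nat.le_mul_of_pos_right _ (by omega)
      _ = (d + 1).choose (2 * m) * (d + 1 - 2 * m) := e
      _ ≤ (d + 1).choose (2 * m) * (d + 1) := Nat.mul_le_mul_left _ (by omega)
      _ = _ := mul_comm _ _
  · rw [h, Nat.choose_self]; nlinarith

lemma denom_le (d m : ℕ) (hd : 4 ≤ d) (hm : 2 * m ≤ d) :
    (2 * d * 4 ^ m * Real.exp d * ((d + 1).choose (2 * m)) : ℝ) ≤ 2 ^ (6 * d) := by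
  have h1 : (2 * d : ℝ) ≤ 2 ^ d := by
    have : 2 * d ≤ 2 ^ d := by
      clear hm
      induction d, hd using Nat.le_induction with
      | base => norm_num
      | succ k hk ih => rw [pow_succ]; omega
    exact_mod_cast this
  have h2 : (4 : ℝ) ^ m ≤ 2 ^ d := by
    have : (4 : ℝ) ^ m = 2 ^ (2 * m) := by rw [pow_mul]; norm_num
    rw [this]
    exact pow_le_pow_right₀ (by norm_num) hm
  have h3 : Real.exp d ≤ 4 ^ d := by
    have : Real.exp d = Real.exp 1 ^ d := by rw [← Real.exp_nat_mul]; simp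
    rw [this]
    gcongr
    linarith [Real.exp_one_lt_d9]
  have h4 : ((d + 1).choose (2 * m) : ℝ) ≤ 4 ^ d := by
    have h : (d + 1).choose (2 * m) ≤ 2 ^ (d + 1) := Nat.choose_le_two_pow _ _
    have h' : 2 ^ (d + 1) ≤ 4 ^ d := by
      have : 4 ^ d = 2 ^ (2 * d) := by rw [pow_mul]; norm_num
      rw [this]
      exact Nat.pow_le_pow_right (by norm_num) (by omega)
    exact_mod_cast h.trans h'
  calc (2 * d * 4 ^ m * Real.exp d * ((d + 1).choose (2 * m)) : ℝ)
      ≤ 2 ^ d * 2 ^ d * 4 ^ d * 4 ^ d := by gcongr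
    _ = 2 ^ (6 * d) := by
      have : (4 : ℝ) ^ d = 2 ^ (2 * d) := by rw [pow_mul]; norm_num
      rw [this, ← pow_add, ← pow_add, ← pow_add]; congr 1; ring

open Classical in
lemma exists_m {G : Type*} [AddCommGroup G] (A : Finset G) (hA : 2 ≤ #A) (d : ℕ) (L M : ℝ)
    (hd4 : 4 ≤ d) (hM : 4 ≤ M) (hL : (#A : ℝ) = 2 ^ L) (hL1 : 1 ≤ L) (hdM : (d : ℝ) = M * L)
    (hd : d = addDim 1 A) :
    ∃ m : ℕ, 1 / 48 * L / Real.logb 2 M ≤ m ∧ 2 * m ≤ d ∧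
      (#A : ℝ) ^ (2 * m) / (2 * d * 4 ^ m * Real.exp d * ((d + 1).choose (2 * m))) ≤ Tk m A := by
  have hlog : 2 ≤ Real.logb 2 M := by
    rw [Real.le_logb_iff_rpow_le (by norm_num) (by linarith)]
    norm_num; linarith
  have hN0 : (0 : ℝ) < #A := by exact_mod_cast (by omega : 0 < #A)
  have hd0 : (4 : ℝ) ≤ d := by exact_mod_cast hd4
  by_cases hc : 1 / 48 * L / Real.logb 2 M ≤ 1
  · refine ⟨1, by simpa using hc, by omega, ?_⟩
    have hT : (#A : ℝ) ≤ Tk 1 A := by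
      have := pow_le_Tk 1 A
      rw [pow_one] at this
      exact_mod_cast this
    refine le_trans ?_ hT
    have hch : (1 : ℝ) ≤ ((d + 1).choose (2 * 1) : ℝ) := by
      exact_mod_cast Nat.choose_pos (by omega : 2 * 1 ≤ d + 1)
    rw [div_le_iff₀ (by positivity)]
    have hNe : (#A : ℝ) ≤ Real.exp d := by
      rw [hL, Real.rpow_def_of_pos (by norm_num)]
      apply Real.exp_le_exp.2
      have := Real.log_two_lt_d9
      nlinarith
    have : (#A : ℝ) ≤ 2 * d * 4 ^ 1 * Real.exp d * ((d + 1).choose (2 * 1)) := by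
      have h8 : (1 : ℝ) ≤ 2 * d * 4 ^ 1 := by linarith
      calc (#A : ℝ) ≤ 1 * Real.exp d * 1 := by linarith
        _ ≤ _ := by gcongr
    calc (#A : ℝ) ^ (2 * 1) = #A * #A := by ring
      _ ≤ _ := by gcongr
  · push Not at hc
    by_contra hcon
    push Not at hcon
    set K : ℝ := L / (12 * Real.logb 2 M) with hK
    have hK4 : K = 4 * (1 / 48 * L / Real.logb 2 M) := by rw [hK]; field_simp; norm_num
    have hL2 : 2 ≤ L := by
      rw [lt_div_iff₀ (by linarith)] at hc
      linarith
    have hshort := short_count d L M K hd4 hM hL2 hdM hK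
    rw [← hL] at hshort
    have hsum := pow_le_sum A
    rw [← hd] at hsum
    have hsumR : (#A : ℝ) ^ (d + 1) ≤
        ∑ ε ∈ (signs (d + 1)).filter (fun ε => ∃ i, ε i ≠ 0), (#(solSet A ε) : ℝ) := by
      exact_mod_cast hsum
    set S := (signs (d + 1)).filter (fun ε => ∃ i, ε i ≠ 0) with hS
    have hNn : (0 : ℝ) < (#A : ℝ) ^ (d + 1) := by positivity
    rw [← Finset.sum_filter_add_sum_filter_not S (fun ε => (#(spt ε) : ℝ) < K)] at hsumR
    have hA1 : ∑ ε ∈ S with (#(spt ε) : ℝ) < K, (#(solSet A ε) : ℝ) ≤ (#A : ℝ) ^ (d + 1) / 2 := by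
      have e1 : ∑ ε ∈ S with (#(spt ε) : ℝ) < K, (#(solSet A ε) : ℝ) ≤
          ∑ ε ∈ S with (#(spt ε) : ℝ) < K, (#A : ℝ) ^ (d + 1) / #A := by
        refine Finset.sum_le_sum fun ε hε => ?_
        have h1 := (Finset.mem_filter.1 (Finset.mem_filter.1 hε).1)
        obtain ⟨i, hi⟩ := h1.2
        rw [le_div_iff₀ hN0]
        exact_mod_cast solSet_mul_le A h1.1 i hi
      refine e1.trans ?_
      rw [Finset.sum_const, nsmul_eq_mul]
      have e2 : (#{ε ∈ S | (#(spt ε) : ℝ) < K} : ℝ) ≤ #A / 2 := by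
        refine le_trans ?_ hshort
        norm_cast
        apply Finset.card_le_card
        intro ε hε
        simp only [Finset.mem_filter, hS] at hε ⊢
        exact ⟨hε.1.1, hε.2⟩
      calc (#{ε ∈ S | (#(spt ε) : ℝ) < K} : ℝ) * ((#A : ℝ) ^ (d + 1) / #A)
          ≤ #A / 2 * ((#A : ℝ) ^ (d + 1) / #A) := by gcongr
        _ = _ := by field_simp
    have hA2 : ∑ ε ∈ S with ¬ (#(spt ε) : ℝ) < K, (#(solSet A ε) : ℝ) < (#A : ℝ) ^ (d + 1) / 2 := by
      have hmaps : ∀ ε ∈ {ε ∈ S | ¬ (#(spt ε) : ℝ) < K}, #(spt ε) ∈ Finset.Icc 1 (d + 1) := by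
        intro ε hε
        have h1 := (Finset.mem_filter.1 hε).2
        have h2 : #(spt ε) ≤ d + 1 := (Finset.card_le_univ _).trans (by simp)
        rw [Finset.mem_Icc]
        refine ⟨?_, h2⟩
        by_contra h0
        have : #(spt ε) = 0 := by omega
        apply h1
        rw [this, hK4]; push_cast; linarith
      rw [← Finset.sum_fiberwise_of_maps_to hmaps]
      have hE : 0 < Real.exp d := Real.exp_pos _
      have hbound : ∀ s ∈ Finset.Icc 1 (d + 1),
          ∑ ε ∈ {ε ∈ S | ¬ (#(spt ε) : ℝ) < K} with #(spt ε) = s, (#(solSet A ε) : ℝ) ≤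
            (#A : ℝ) ^ (d + 1) * (2 * (d + 1) / (d * Real.exp d)) := by
        intro s hs
        rw [Finset.mem_Icc] at hs
        by_cases hsK : (s : ℝ) < K
        · rw [Finset.filter_eq_empty_iff.2]
          · simp; positivity
          · intro ε hε h
            exact (Finset.mem_filter.1 hε).2 (h ▸ hsK)
        push Not at hsK
        obtain ⟨m, hm⟩ : ∃ m, m = min (s / 2) (d / 2) := ⟨_, rfl⟩
        have h2m : 2 * m ≤ d := by omega
        have h2ms : 2 * m ≤ s := by omega
        have hms : (s : ℝ) ≤ 2 * m + 2 := by
          have : s ≤ 2 * m + 2 := by omega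
          exact_mod_cast this
        have hcm : 1 / 48 * L / Real.logb 2 M ≤ m := by linarith
        have hT := hcon m hcm h2m
        set D : ℝ := 2 * d * 4 ^ m * Real.exp d * ((d + 1).choose (2 * m)) with hD
        have hch : (1 : ℝ) ≤ ((d + 1).choose (2 * m) : ℝ) := by
          exact_mod_cast Nat.choose_pos (by omega : 2 * m ≤ d + 1)
        have hD0 : 0 < D := by positivity
        have hR : ∀ ε ∈ ({ε ∈ S | ¬ (#(spt ε) : ℝ) < K} : Finset _).filter (fun ε => #(spt ε) = s),
            (#(solSet A ε) : ℝ) ≤ (#A : ℝ) ^ (d + 1) / D := by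
          intro ε hε
          have h1 := Finset.mem_filter.1 hε
          have h2 := Finset.mem_filter.1 (Finset.mem_filter.1 h1.1).1
          have h3 : (#(solSet A ε) : ℝ) * (#A : ℝ) ^ (2 * m) ≤ Tk m A * (#A : ℝ) ^ (d + 1) := by
            exact_mod_cast solSet_le_Tk A h2.1 m (by rw [h1.2]; exact h2ms)
          have hp : (0 : ℝ) < (#A : ℝ) ^ (2 * m) := by positivity
          have h4 : (Tk m A : ℝ) * (#A : ℝ) ^ (d + 1) ≤
              (#A : ℝ) ^ (2 * m) / D * (#A : ℝ) ^ (d + 1) := by gcongr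
          have h5 := h3.trans h4
          rw [← mul_le_mul_iff_left₀ hp]
          refine h5.trans (le_of_eq ?_)
          ring
        refine (Finset.sum_le_card_nsmul _ _ _ hR).trans ?_
        rw [nsmul_eq_mul]
        have hcard : (#(({ε ∈ S | ¬ (#(spt ε) : ℝ) < K} : Finset _).filter
            (fun ε => #(spt ε) = s)) : ℝ) ≤
            4 * 4 ^ m * ((d + 1) * ((d + 1).choose (2 * m) : ℝ)) := by
          have h1 : #(({ε ∈ S | ¬ (#(spt ε) : ℝ) < K} : Finset _).filter
            (fun ε => #(spt ε) = s)) ≤ #{ε ∈ signs (d + 1) | #(spt ε) = s} := by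
            apply Finset.card_le_card
            intro ε hε
            simp only [Finset.mem_filter, hS] at hε ⊢
            exact ⟨hε.1.1.1, hε.2⟩
          exact_mod_cast (h1.trans (card_signs_spt (d + 1) s)).trans
            (choose_bound d s m hd4 hs.2 hm)
        calc _ ≤ 4 * 4 ^ m * ((d + 1) * ((d + 1).choose (2 * m) : ℝ)) * ((#A : ℝ) ^ (d + 1) / D) := by
              gcongr
          _ = (#A : ℝ) ^ (d + 1) * (2 * (d + 1) / (d * Real.exp d)) := by
              rw [hD]; field_simp; norm_num
      refine (Finset.sum_le_card_nsmul _ _ _ hbound).trans_lt ?_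
      have hexp := exp_bound d hd4
      rw [nsmul_eq_mul, Nat.card_Icc]
      have e : ((d + 1 + 1 - 1 : ℕ) : ℝ) * ((#A : ℝ) ^ (d + 1) * (2 * (d + 1) / (d * Real.exp d))) =
          (#A : ℝ) ^ (d + 1) * (2 * (d + 1) ^ 2 / (d * Real.exp d)) := by
        simp only [Nat.add_sub_cancel]; push_cast; ring
      rw [e, div_eq_mul_inv _ (2 : ℝ)]
      apply mul_lt_mul_of_pos_left _ hNn
      rw [div_lt_iff₀ (by positivity)]
      linarith
    linarith

theorem stmt11 :
    ∃ c Cs : ℝ, 0 < c ∧ 0 < Cs ∧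
      ∀ (G : Type u) [AddCommGroup G] (A : Finset G),
        2 ≤ A.card →
        ∀ (d : ℕ) (M : ℝ),
          d = addDim 1 A → M = (d : ℝ) / Real.logb 2 A.card → 4 ≤ M →
          ∃ m : ℕ,
            c * Real.logb 2 A.card / Real.logb 2 M ≤ (m : ℝ) ∧
            (m : ℝ) ≤ (d : ℝ) / 2 ∧
            (Tk m A : ℝ) ≥
              (A.card : ℝ) ^ (2 * m) /
                (2 * d * 4 ^ m * Real.exp d * ((d + 1).choose (2 * m))) ∧
            (A.card : ℝ) ^ (2 * m) /
                (2 * d * 4 ^ m * Real.exp d * ((d + 1).choose (2 * m))) ≥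
              (A.card : ℝ) ^ (2 * m) / (A.card : ℝ) ^ (Cs * M) := by
  refine ⟨1 / 48, 6, by norm_num, by norm_num, ?_⟩
  intro G _ A hA d M hd hMd hM
  have hA' : (2 : ℝ) ≤ (A.card : ℝ) := by exact_mod_cast hA
  set L := Real.logb 2 A.card with hLdef
  have hL1 : 1 ≤ L := by
    rw [hLdef, Real.le_logb_iff_rpow_le (by norm_num) (by linarith)]
    simpa using hA'
  have hL : (A.card : ℝ) = 2 ^ L :=
    (Real.rpow_logb (by norm_num) (by norm_num) (by linarith)).symm
  have hdM : (d : ℝ) = M * L := by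
    rw [hMd, div_mul_cancel₀ _ (zero_lt_one.trans_le hL1).ne']
  have hd4 : 4 ≤ d := by
    have : (4 : ℝ) ≤ d := by rw [hdM]; nlinarith
    exact_mod_cast this
  obtain ⟨m, h1, h2, h3⟩ := exists_m A hA d L M hd4 hM hL hL1 hdM hd
  refine ⟨m, h1, ?_, h3, ?_⟩
  · have : (2 * m : ℝ) ≤ d := by exact_mod_cast h2
    linarith
  · have hden := denom_le d m hd4 h2
    have e : (A.card : ℝ) ^ (6 * M) = 2 ^ (6 * d) := by
      rw [hL, ← Real.rpow_mul (by norm_num), ← Real.rpow_natCast]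
      congr 1
      push_cast
      rw [hdM]; ring
    rw [e]
    have hch : (1 : ℝ) ≤ ((d + 1).choose (2 * m) : ℝ) := by
      exact_mod_cast Nat.choose_pos (by omega : 2 * m ≤ d + 1)
    have hd0 : (4 : ℝ) ≤ d := by exact_mod_cast hd4
    have hden0 : (0 : ℝ) < 2 * d * 4 ^ m * Real.exp d * ((d + 1).choose (2 * m)) := by
      positivity
    have hnum : (0 : ℝ) ≤ (A.card : ℝ) ^ (2 * m) := pow_nonneg (by linarith) _
    exact div_le_div_of_nonneg_left hnum hden0 hden
end

section
/- There is an absolute constant C > 0 with the following property. Let R be a commutative ring with no zero divisors, A ⊆ R a finite set with |A·A| ≤ D·|A| for some real D ≥ 1, and let d = dim(A) be the additive dimension of A; assume d ≥ 2. Then for every positive integer k: T_k^+(A) ≤ |A|^{2k} · ( C·k·D⁶·log²d / d )^k. -/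
open Finset Pointwise

universe u

lemma aux_char {G : Type u} [AddCommGroup G] (g : G) (hg : g ≠ 0) :
    ∃ χ : AddChar G ℂ, χ g ≠ 1 ∧ (∀ x, ‖χ x‖ = 1) ∧ ∀ x, ∃ N : ℕ, 0 < N ∧ χ x ^ N = 1 := by
  obtain ⟨c, hc⟩ := CharacterModule.exists_character_apply_ne_zero_of_ne_zero hg
  let m : AddCircle (1 : ℚ) →+ AddCircle (1 : ℝ) :=
    QuotientAddGroup.map _ _ (Rat.castHom ℝ).toAddMonoidHom (by
      intro x hx
      obtain ⟨n, rfl⟩ := AddSubgroup.mem_zmultiples_iff.1 hx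
      simp [AddSubgroup.mem_zmultiples_iff])
  have hm : ∀ x, m x = 0 → x = 0 := by
    intro x
    induction x using QuotientAddGroup.induction_on with
    | H q =>
      intro h
      have h1 : ((q : ℝ) : AddCircle (1 : ℝ)) = 0 := h
      rw [AddCircle.coe_eq_zero_iff] at h1
      obtain ⟨n, hn⟩ := h1
      refine (AddCircle.coe_eq_zero_iff (1 : ℚ)).2 ⟨n, ?_⟩
      simp at hn ⊢
      exact_mod_cast hn
  let χ : AddChar G Circle :=
          { toFun := fun x => AddCircle.toCircle (m (c x))
            map_zero_eq_one' := by simp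
            map_add_eq_mul' := by intro a b; simp [AddCircle.toCircle_add] }
  refine ⟨Circle.coeHom.compAddChar χ, ?_, fun x => Circle.norm_coe (χ x), ?_⟩
  · intro h
    apply hc
    apply hm
    apply AddCircle.injective_toCircle (T := (1 : ℝ)) one_ne_zero
    have h' : χ g = 1 := Circle.ext h
    simpa [χ] using h'
  · intro x
    have : ∃ N : ℕ, 0 < N ∧ N • (c x) = 0 := by
      generalize c x = y
      induction y using QuotientAddGroup.induction_on with
      | H q =>
        refine ⟨q.den, q.den_pos, ?_⟩
        have : q.den • (q : AddCircle (1 : ℚ)) = ((q.den • q : ℚ) : AddCircle (1 : ℚ)) := rfl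
        refine this.trans ?_
        rw [AddCircle.coe_eq_zero_iff]
        refine ⟨q.num, ?_⟩
        simp [Rat.den_mul_eq_num]
    obtain ⟨N, h0, hN⟩ := this
    refine ⟨N, h0, ?_⟩
    have : χ x ^ N = 1 := by
      change AddCircle.toCircle (m (c x)) ^ N = 1
      rw [← AddCircle.toCircle_nsmul, ← map_nsmul, hN]
      simp
    change Circle.coeHom (χ x) ^ N = 1
    rw [← map_pow, this, map_one]

lemma aux_mean {G : Type u} [AddCommGroup G] (W : Finset G) :
    ∃ (Ψ : Type u) (_ : Fintype Ψ) (_ : Nonempty Ψ) (e : Ψ → AddChar G ℂ),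
      (∀ ψ g, ‖e ψ g‖ = 1) ∧ ∀ g ∈ W, g ≠ 0 → ∑ ψ, e ψ g = 0 := by
  classical
  have h1 : ∀ w : G, ∃ χ : AddChar G ℂ, (w ≠ 0 → χ w ≠ 1) ∧ (∀ x, ‖χ x‖ = 1) ∧
      ∀ x, ∃ N : ℕ, 0 < N ∧ χ x ^ N = 1 := by
    intro w
    by_cases hw : w = 0
    · exact ⟨1, fun h => absurd hw h, fun x => by simp, fun x => ⟨1, one_pos, by simp⟩⟩
    · obtain ⟨χ, h, h'⟩ := aux_char w hw
      exact ⟨χ, fun _ => h, h'⟩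
  choose χ hχ hχn hN using h1
  choose N hN0 hN1 using hN
  let M : ℕ := ∏ w ∈ W, N w w
  have hM : 0 < M := Finset.prod_pos fun w _ => hN0 w w
  have hM1 : ∀ w ∈ W, (χ w w) ^ M = 1 := by
    intro w hw
    obtain ⟨q, hq⟩ := Finset.dvd_prod_of_mem (fun w => N w w) hw
    have : M = N w w * q := hq
    rw [this, pow_mul, hN1, one_pow]
  have : Nonempty (Fin M) := ⟨⟨0, hM⟩⟩
  refine ⟨(↥W → Fin M), inferInstance, inferInstance, fun n => ∏ w : ↥W, χ w ^ (n w : ℕ), ?_, ?_⟩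
  · intro n g
    rw [AddChar.prod_apply, norm_prod]
    exact Finset.prod_eq_one fun w _ => by simp [hχn]
  intro g hg hg0
  simp_rw [AddChar.prod_apply, AddChar.pow_apply]
  rw [← Fintype.prod_sum (fun (w : ↥W) (j : Fin M) => (χ w g) ^ (j : ℕ))]
  apply Finset.prod_eq_zero (Finset.mem_univ (⟨g, hg⟩ : ↥W))
  rw [Fin.sum_univ_eq_sum_range (fun j => (χ g g : ℂ) ^ j) M, geom_sum_eq (hχ g hg0), hM1 g hg]
  simp

lemma aux_re {G : Type u} [AddCommGroup G] (χ : AddChar G ℂ) (h : ∀ g, ‖χ g‖ = 1) (g : G) :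
    (((χ g).re : ℝ) : ℂ) = (χ g + χ (-g)) / 2 := by
  have : χ (-g) = (starRingEnd ℂ) (χ g) := by
    rw [← Complex.inv_eq_conj (h g)]
    apply eq_inv_of_mul_eq_one_left
    rw [← AddChar.map_add_eq_mul]
    simp
  rw [Complex.re_eq_add_conj, this]

lemma aux_map_sum {G : Type u} [AddCommGroup G] (χ : AddChar G ℂ) {ι : Type*} (s : Finset ι)
    (f : ι → G) : χ (∑ i ∈ s, f i) = ∏ i ∈ s, χ (f i) := by
  classical
  induction s using Finset.induction_on with
  | empty => simp
  | insert a s ha ih => rw [Finset.sum_insert ha, Finset.prod_insert ha, AddChar.map_add_eq_mul, ih]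

lemma aux_riesz {G : Type u} [AddCommGroup G] {ι : Type*} [Fintype ι]
    {Ψ : Type*} [Fintype Ψ] (e : Ψ → AddChar G ℂ) (hn : ∀ ψ g, ‖e ψ g‖ = 1) (b : ι → G)
    (h : ∀ ε : ι → ℤ, (∀ i, |ε i| ≤ 1) → ε ≠ 0 → ∑ ψ, (e ψ (∑ i, ε i • b i) : ℂ) = 0)
    (t : ℝ) :
    ∑ ψ, ∏ i, (Real.cosh t + (e ψ (b i)).re * Real.sinh t)
      = Fintype.card Ψ * Real.cosh t ^ Fintype.card ι := by
  classical
  let w : ℤ → ℂ := fun n => if n = 0 then (Real.cosh t : ℂ) else (Real.sinh t : ℂ) / 2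
  have h1 : ∀ ψ i, ((Real.cosh t + (e ψ (b i)).re * Real.sinh t : ℝ) : ℂ)
      = ∑ n ∈ ({-1, 0, 1} : Finset ℤ), w n * (e ψ (n • b i) : ℂ) := by
    intro ψ i
    have hre : (((e ψ (b i)).re : ℝ) : ℂ) = ((e ψ (b i)) + (e ψ (- b i) : ℂ)) / 2 := by
      exact aux_re _ (hn ψ) _
    rw [Finset.sum_insert (by decide), Finset.sum_insert (by decide), Finset.sum_singleton]
    push_cast
    rw [hre]
    simp [w]
    ring
  have h2 : ∀ ψ, ((∏ i, (Real.cosh t + (e ψ (b i)).re * Real.sinh t) : ℝ) : ℂ)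
      = ∑ ε ∈ Fintype.piFinset (fun _ : ι => ({-1, 0, 1} : Finset ℤ)),
        (∏ i, w (ε i)) * (e ψ (∑ i, ε i • b i) : ℂ) := by
    intro ψ
    rw [Complex.ofReal_prod]
    simp_rw [h1]
    rw [Finset.prod_univ_sum]
    refine Finset.sum_congr rfl fun ε _ => ?_
    rw [Finset.prod_mul_distrib, aux_map_sum]
  have h3 : ((∑ ψ, ∏ i, (Real.cosh t + (e ψ (b i)).re * Real.sinh t) : ℝ) : ℂ)
      = ((Fintype.card Ψ * Real.cosh t ^ Fintype.card ι : ℝ) : ℂ) := by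
    rw [Complex.ofReal_sum]
    simp_rw [h2]
    rw [Finset.sum_comm, Finset.sum_eq_single 0]
    · simp [w, mul_comm]
    · intro ε hε hε0
      rw [← Finset.mul_sum, h ε _ hε0, mul_zero]
      intro i
      have := Fintype.mem_piFinset.1 hε i
      simp at this
      rcases this with h | h | h <;> simp [h]
    · intro h0
      exact absurd (Fintype.mem_piFinset.2 (fun i => by simp)) h0
  exact_mod_cast h3

lemma aux_exp {G : Type u} [AddCommGroup G] {ι : Type*} [Fintype ι]
    {Ψ : Type*} [Fintype Ψ] (e : Ψ → AddChar G ℂ) (hn : ∀ ψ g, ‖e ψ g‖ = 1) (b : ι → G)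
    (h : ∀ ε : ι → ℤ, (∀ i, |ε i| ≤ 1) → ε ≠ 0 → ∑ ψ, (e ψ (∑ i, ε i • b i) : ℂ) = 0)
    (t : ℝ) :
    ∑ ψ, Real.exp (t * ∑ i, (e ψ (b i)).re)
      ≤ Fintype.card Ψ * Real.exp (t ^ 2 / 2 * Fintype.card ι) := by
  calc ∑ ψ, Real.exp (t * ∑ i, (e ψ (b i)).re)
      ≤ ∑ ψ, ∏ i, (Real.cosh t + (e ψ (b i)).re * Real.sinh t) := by
        refine Finset.sum_le_sum fun ψ _ => ?_
        rw [Finset.mul_sum, Real.exp_sum]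
        refine Finset.prod_le_prod (fun i _ => (Real.exp_pos _).le) fun i _ => ?_
        have := Real.exp_mul_le_cosh_add_mul_sinh (t := (e ψ (b i)).re)
          ((Complex.abs_re_le_norm _).trans (hn _ _).le) t
        rwa [mul_comm t]
    _ = _ := aux_riesz e hn b h t
    _ ≤ _ := by
        gcongr
        calc Real.cosh t ^ Fintype.card ι ≤ Real.exp (t ^ 2 / 2) ^ Fintype.card ι := by
              gcongr
              exact Real.cosh_le_exp_half_sq t
          _ = _ := by rw [← Real.exp_nat_mul, mul_comm]

lemma aux_moment {G : Type u} [AddCommGroup G] {ι : Type*} [Fintype ι] [Nonempty ι]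
    {Ψ : Type*} [Fintype Ψ] (e : Ψ → AddChar G ℂ) (hn : ∀ ψ g, ‖e ψ g‖ = 1) (b : ι → G)
    (h : ∀ ε : ι → ℤ, (∀ i, |ε i| ≤ 1) → ε ≠ 0 → ∑ ψ, (e ψ (∑ i, ε i • b i) : ℂ) = 0)
    (k : ℕ) (hk : 1 ≤ k) :
    ∑ ψ, (∑ i, (e ψ (b i)).re) ^ (2 * k)
      ≤ Fintype.card Ψ * (12 * k * Fintype.card ι : ℝ) ^ k := by
  set d : ℝ := ((Fintype.card ι : ℕ) : ℝ) with hd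
  have hd0 : 0 < d := by exact Nat.cast_pos.2 Fintype.card_pos
  have hk0 : (0 : ℝ) < k := by exact_mod_cast hk
  set t : ℝ := Real.sqrt (2 * k / d) with ht
  have ht2 : t ^ 2 = 2 * k / d := Real.sq_sqrt (by positivity)
  have h1 := aux_exp e hn b h t
  have h2 := aux_exp e hn b h (-t)
  rw [← hd] at h1 h2
  have e1 : t ^ 2 / 2 * d = k := by rw [ht2]; field_simp
  have e2 : (-t) ^ 2 / 2 * d = k := by rw [neg_sq]; exact e1
  rw [e1] at h1
  rw [e2] at h2
  have key : ∀ S : ℝ, (2 * k / d) ^ k * S ^ (2 * k)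
      ≤ (2 * k).factorial * (Real.exp (t * S) + Real.exp (-t * S)) := by
    intro S
    have a1 : (2 * k / d) ^ k * S ^ (2 * k) = |t * S| ^ (2 * k) := by
      rw [pow_mul |t * S|, sq_abs, mul_pow, mul_pow, ht2, pow_mul]
    have a2 := Real.pow_div_factorial_le_exp (|t * S|) (abs_nonneg _) (2 * k)
    rw [div_le_iff₀ (by positivity)] at a2
    rw [a1]
    refine a2.trans ?_
    rw [mul_comm]
    gcongr
    rcases abs_cases (t * S) with ⟨h, _⟩ | ⟨h, _⟩ <;> rw [h]
    · linarith [Real.exp_pos (-t * S)]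
    · rw [neg_mul]; linarith [Real.exp_pos (t * S)]
  have h3 : (2 * k / d) ^ k * ∑ ψ, (∑ i, (e ψ (b i)).re) ^ (2 * k)
      ≤ (2 * k).factorial * (2 * (Fintype.card Ψ * Real.exp k)) := by
    rw [Finset.mul_sum]
    refine (Finset.sum_le_sum fun ψ _ => key _).trans ?_
    rw [← Finset.mul_sum, Finset.sum_add_distrib]
    gcongr
    linarith
  have h4 : ((2 * k).factorial : ℝ) ≤ (2 * k : ℝ) ^ (2 * k) := by
    exact_mod_cast Nat.factorial_le_pow (2 * k)
  have h5 : Real.exp k ≤ 3 ^ k := by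
    have : Real.exp k = Real.exp 1 ^ k := by rw [← Real.exp_nat_mul, mul_one]
    rw [this]
    have := Real.exp_one_lt_d9
    gcongr
    linarith
  have h6 : (2 : ℝ) ≤ 2 ^ k := by
    calc (2 : ℝ) = 2 ^ 1 := by norm_num
      _ ≤ 2 ^ k := pow_le_pow_right₀ (by norm_num) hk
  have hp : 0 < (2 * k / d) ^ k := by positivity
  refine le_of_mul_le_mul_left (h3.trans ?_) hp
  calc ((2 * k).factorial : ℝ) * (2 * (Fintype.card Ψ * Real.exp k))
      ≤ (2 * k : ℝ) ^ (2 * k) * (2 ^ k * (Fintype.card Ψ * 3 ^ k)) := by gcongr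
    _ = (2 * k / d) ^ k * (Fintype.card Ψ * (12 * k * d) ^ k) := by
      have : (2 * k / d) ^ k * (Fintype.card Ψ * (12 * k * d) ^ k)
        = Fintype.card Ψ * ((2 * k / d) * (12 * k * d)) ^ k := by rw [mul_pow (2 * k / d)]; ring
      rw [this]
      have : (2 * k / d) * (12 * k * d) = (2 * k : ℝ) ^ 2 * 2 * 3 := by field_simp; ring
      rw [this, mul_pow _ (3 : ℝ), mul_pow _ (2 : ℝ), ← pow_mul]
      ring

def auxSgn {G : Type*} [AddCommGroup G] {I : Type*} (b : I → G) (p : I × Bool) : G :=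
  if p.2 then b p.1 else - b p.1

lemma aux_lower {G : Type u} [AddCommGroup G] {I J : Type*} [Fintype I] [Fintype J]
    {Ψ : Type*} [Fintype Ψ] (e : Ψ → AddChar G ℂ) (hn : ∀ ψ g, ‖e ψ g‖ = 1) (b : I → G)
    (h : ∀ F : J → I × Bool, ∑ j, auxSgn b (F j) ≠ 0 →
      ∑ ψ, e ψ (∑ j, auxSgn b (F j)) = 0) :
    (Fintype.card Ψ : ℝ) * Set.ncard {F : J → I × Bool | ∑ j, auxSgn b (F j) = 0}
      = ∑ ψ, (2 * ∑ i, (e ψ (b i)).re) ^ (Fintype.card J) := by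
  classical
  have h1 : ∀ ψ, ((2 * ∑ i, (e ψ (b i)).re : ℝ) : ℂ) = ∑ p : I × Bool, e ψ (auxSgn b p) := by
    intro ψ
    push_cast
    simp_rw [aux_re _ (hn ψ)]
    rw [Fintype.sum_prod_type, Finset.mul_sum]
    refine Finset.sum_congr rfl fun i _ => ?_
    simp [auxSgn]
    ring
  have h2 : ∀ ψ, (((2 * ∑ i, (e ψ (b i)).re) ^ (Fintype.card J) : ℝ) : ℂ)
      = ∑ F : J → I × Bool, e ψ (∑ j, auxSgn b (F j)) := by
    intro ψ
    rw [Complex.ofReal_pow, h1, ← Finset.card_univ, ← Finset.prod_const, Fintype.prod_sum]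
    simp_rw [aux_map_sum]
  have h3 : (((Fintype.card Ψ : ℝ) * Set.ncard {F : J → I × Bool | ∑ j, auxSgn b (F j) = 0} : ℝ) : ℂ)
      = ((∑ ψ, (2 * ∑ i, (e ψ (b i)).re) ^ (Fintype.card J) : ℝ) : ℂ) := by
    rw [Complex.ofReal_sum]
    simp_rw [h2]
    rw [Finset.sum_comm]
    have h4 : ∀ F : J → I × Bool, ∑ ψ, e ψ (∑ j, auxSgn b (F j))
        = if ∑ j, auxSgn b (F j) = 0 then (Fintype.card Ψ : ℂ) else 0 := by
      intro F
      split_ifs with hF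
      · simp [hF]
      · exact h F hF
    simp_rw [h4]
    rw [← Finset.sum_filter, Finset.sum_const, Set.ncard_eq_toFinset_card']
    simp [mul_comm]
  exact_mod_cast h3

lemma aux_count {G : Type u} [AddCommGroup G] {I L : Type*} [Finite I] [Fintype L]
    (A : Finset G) (b : I → G) (φ : G →+ G) (c : G → L → I)
    (hb : ∀ a ∈ A, ∀ l, b (c a l) = φ a)
    (hc : ∀ a ∈ A, ∀ a' ∈ A, ∀ l l', c a l = c a' l' → a = a' ∧ l = l') (k : ℕ) :
    Tk k A * (Fintype.card L) ^ (2 * k) ≤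
      Set.ncard {F : Fin k ⊕ Fin k → I × Bool | ∑ j, auxSgn b (F j) = 0} := by
  have h1 : (Fintype.card L) ^ (2 * k) =
      Set.ncard (Set.univ : Set (Fin k ⊕ Fin k → L)) := by
    rw [Set.ncard_univ, Nat.card_eq_fintype_card, Fintype.card_fun]
    simp [two_mul]
  rw [h1, Tk, ← Set.ncard_prod]
  refine Set.ncard_le_ncard_of_injOn
    (fun q => Sum.elim (fun j => (c (q.1.1 j) (q.2 (Sum.inl j)), true))
      (fun j => (c (q.1.2 j) (q.2 (Sum.inr j)), false))) ?_ ?_ (Set.toFinite _)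
  · rintro ⟨⟨f, g⟩, l⟩ ⟨⟨hf, hg, hs⟩, -⟩
    simp only [Set.mem_ofPred_eq] at hf hg hs ⊢
    rw [Fintype.sum_sum_type]
    simp only [Sum.elim_inl, Sum.elim_inr, auxSgn]
    simp only [if_true, Bool.false_eq_true, if_false]
    rw [Finset.sum_neg_distrib, Finset.sum_congr rfl (fun j _ => hb _ (hf j) _),
      Finset.sum_congr rfl (fun j _ => hb _ (hg j) _), ← map_sum, ← map_sum, hs]
    simp
  · rintro ⟨⟨f, g⟩, l⟩ ⟨⟨hf, hg, hs⟩, -⟩ ⟨⟨f', g'⟩, l'⟩ ⟨⟨hf', hg', hs'⟩, -⟩ heq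
    simp only at hf hg hf' hg' heq
    have a1 : ∀ j, f j = f' j ∧ l (Sum.inl j) = l' (Sum.inl j) := fun j => by
      have := congrFun heq (Sum.inl j)
      simp only [Sum.elim_inl, Prod.mk.injEq, and_true] at this
      exact hc _ (hf j) _ (hf' j) _ _ this
    have a2 : ∀ j, g j = g' j ∧ l (Sum.inr j) = l' (Sum.inr j) := fun j => by
      have := congrFun heq (Sum.inr j)
      simp only [Sum.elim_inr, Prod.mk.injEq, and_true] at this
      exact hc _ (hg j) _ (hg' j) _ _ this
    simp only [Prod.mk.injEq]
    refine ⟨⟨funext fun j => (a1 j).1, funext fun j => (a2 j).1⟩, funext fun j => ?_⟩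
    rcases j with j | j
    · exact (a1 j).2
    · exact (a2 j).2

lemma aux_jensen {X Ψ : Type*} [Fintype X] [Fintype Ψ] (S : X → Ψ → ℝ) (k : ℕ) (hk : 1 ≤ k)
    (B d : ℝ) (hS : ∀ x, ∑ ψ, S x ψ ^ (2 * k) ≤ Fintype.card Ψ * B)
    (hd : d ^ (2 * k) ≤ (Fintype.card X : ℝ) ^ (2 * k) * B) :
    ∑ ψ, (2 * (∑ x, S x ψ + d)) ^ (2 * k)
      ≤ Fintype.card Ψ * (16 ^ k * ((Fintype.card X : ℝ) ^ (2 * k) * B)) := by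
  have hev : Even (2 * k) := even_two_mul k
  obtain ⟨n, hn⟩ : ∃ n, 2 * k = n + 1 := ⟨2 * k - 1, by omega⟩
  have h1 : ∀ ψ, (∑ x, S x ψ) ^ (2 * k) ≤
      (Fintype.card X : ℝ) ^ n * ∑ x, S x ψ ^ (2 * k) := by
    intro ψ
    rcases isEmpty_or_nonempty X with hX | hX
    · simp [hn]
    have hc : (0 : ℝ) < Fintype.card X := Nat.cast_pos.2 Fintype.card_pos
    have h := pow_sum_div_card_le_sum_pow (s := (Finset.univ : Finset X)) (f := fun x => |S x ψ|)
      (fun _ _ => abs_nonneg _) n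
    rw [← hn, div_le_iff₀ (by positivity), Finset.card_univ] at h
    simp only [hev.pow_abs] at h
    rw [mul_comm ((Fintype.card X : ℝ) ^ n)]
    refine le_trans ?_ h
    rw [← hev.pow_abs]
    gcongr
    exact Finset.abs_sum_le_sum_abs _ _
  have h2 : ∑ ψ, (∑ x, S x ψ) ^ (2 * k) ≤
      Fintype.card Ψ * ((Fintype.card X : ℝ) ^ (2 * k) * B) := by
    calc _ ≤ ∑ ψ, (Fintype.card X : ℝ) ^ n * ∑ x, S x ψ ^ (2 * k) :=
          Finset.sum_le_sum fun ψ _ => h1 ψ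
      _ = (Fintype.card X : ℝ) ^ n * ∑ x, ∑ ψ, S x ψ ^ (2 * k) := by
          rw [← Finset.mul_sum, Finset.sum_comm]
      _ ≤ (Fintype.card X : ℝ) ^ n * ∑ x : X, (Fintype.card Ψ * B) := by
          gcongr with x
          exact hS x
      _ = _ := by
          rw [Finset.sum_const, Finset.card_univ, nsmul_eq_mul, hn, pow_succ]; ring
  have h3 : ∀ ψ, (2 * (∑ x, S x ψ + d)) ^ (2 * k) ≤
      (2 ^ (2 * k) * 2 ^ n) * ((∑ x, S x ψ) ^ (2 * k) + d ^ (2 * k)) := by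
    intro ψ
    rw [mul_pow, mul_assoc]
    gcongr
    have := hev.add_pow_le (a := ∑ x, S x ψ) (b := d)
    rwa [show 2 * k - 1 = n by omega] at this
  calc _ ≤ ∑ ψ, (2 ^ (2 * k) * 2 ^ n) * ((∑ x, S x ψ) ^ (2 * k) + d ^ (2 * k)) :=
        Finset.sum_le_sum fun ψ _ => h3 ψ
    _ = (2 ^ (2 * k) * 2 ^ n) * (∑ ψ, (∑ x, S x ψ) ^ (2 * k) + Fintype.card Ψ * d ^ (2 * k)) := by
        rw [← Finset.mul_sum, Finset.sum_add_distrib, Finset.sum_const, Finset.card_univ,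
          nsmul_eq_mul]
    _ ≤ (2 ^ (2 * k) * 2 ^ n) * (Fintype.card Ψ * ((Fintype.card X : ℝ) ^ (2 * k) * B)
          + Fintype.card Ψ * ((Fintype.card X : ℝ) ^ (2 * k) * B)) := by
        gcongr
    _ = _ := by
        have : (16 : ℝ) ^ k = 2 ^ (2 * k) * (2 ^ n * 2) := by
          rw [← pow_succ, ← hn, ← pow_add, ← two_mul, ← mul_assoc, pow_mul]; norm_num
        rw [this]; ring

lemma aux_main (R : Type u) [CommRing R] [NoZeroDivisors R] [DecidableEq R] (A Λ : Finset R)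
    (hΛA : Λ ⊆ A) (hdis : IsKDissociated 1 Λ) (hne : Λ.Nonempty) (k : ℕ) (hk : 1 ≤ k) :
    ∃ X : Finset R, X.card * (A.erase 0).card ≤ (A * A).card ^ 2 ∧
      (Tk k A : ℝ) * (Λ.card : ℝ) ^ (2 * k)
        ≤ 16 ^ k * ((X.card : ℝ) ^ (2 * k) * (12 * k * Λ.card) ^ k) := by
  have h0 : (0 : R) ∉ Λ := by
    intro h
    have := hdis (fun x => if x = 0 then 1 else 0) (by intro x _; split_ifs <;> simp)
      (by apply Finset.sum_eq_zero; intro x _; split_ifs with hx <;> simp [hx]) 0 h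
    simp at this
  have hne0 : ∀ l ∈ Λ, l ≠ 0 := fun l hl h => h0 (h ▸ hl)
  obtain ⟨l₀, hl₀⟩ := hne
  have : Nontrivial R := ⟨l₀, 0, hne0 _ hl₀⟩
  have : Nonempty ↥Λ := ⟨⟨l₀, hl₀⟩⟩
  have hdom : IsDomain R := NoZeroDivisors.to_isDomain R
  set M : R := ∏ l ∈ Λ, l with hM
  let m : R → R := fun l => ∏ l' ∈ Λ.erase l, l'
  have hm : ∀ l ∈ Λ, m l * l = M := fun l hl => Finset.prod_erase_mul Λ (fun x => x) hl
  have hM0 : M ≠ 0 := Finset.prod_ne_zero_iff.2 hne0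
  have hm0 : ∀ l ∈ Λ, m l ≠ 0 := fun l hl h => hM0 (by rw [← hm l hl, h, zero_mul])
  let X : Finset R := Finset.image₂ (fun a l => a * m l) (A.erase 0) Λ
  have hX0 : ∀ x ∈ X, x ≠ 0 := by
    intro x hx
    obtain ⟨a, ha, l, hl, rfl⟩ := Finset.mem_image₂.1 hx
    exact mul_ne_zero (Finset.ne_of_mem_erase ha) (hm0 l hl)
  have hXcard : X.card * (A.erase 0).card ≤ (A * A).card ^ 2 := by
    have hch : ∀ x : R, ∃ p : R × R, x ∈ X → p.1 ∈ A.erase 0 ∧ p.2 ∈ Λ ∧ p.1 * m p.2 = x := by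
      intro x
      by_cases hx : x ∈ X
      · obtain ⟨a, ha, l, hl, h⟩ := Finset.mem_image₂.1 hx
        exact ⟨(a, l), fun _ => ⟨ha, hl, h⟩⟩
      · exact ⟨(0, 0), fun h => absurd h hx⟩
    choose p hp using hch
    rw [← Finset.card_product, sq, ← Finset.card_product]
    refine Finset.card_le_card_of_injOn (fun q => ((p q.1).1 * q.2, (p q.1).2 * q.2)) ?_ ?_
    · rintro ⟨x, a⟩ hq
      obtain ⟨hx, ha⟩ := Finset.mem_product.1 (Finset.mem_coe.1 hq)
      obtain ⟨h1, h2, h3⟩ := hp x hx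
      have ha' := Finset.mem_of_mem_erase ha
      exact Finset.mem_coe.2 (Finset.mem_product.2
        ⟨Finset.mul_mem_mul (Finset.mem_of_mem_erase h1) ha', Finset.mul_mem_mul (hΛA h2) ha'⟩)
    · rintro ⟨x, a⟩ hq ⟨x', a'⟩ hq' heq
      obtain ⟨hx, ha⟩ := Finset.mem_product.1 (Finset.mem_coe.1 hq)
      obtain ⟨hx', ha'⟩ := Finset.mem_product.1 (Finset.mem_coe.1 hq')
      simp only at hx ha hx' ha'
      obtain ⟨h1, h2, h3⟩ := hp x hx
      obtain ⟨h1', h2', h3'⟩ := hp x' hx'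
      simp only [Prod.mk.injEq] at heq
      obtain ⟨e1, e2⟩ := heq
      have n1 := Finset.ne_of_mem_erase ha
      have n2 := Finset.ne_of_mem_erase ha'
      have n3 := hne0 _ h2
      have n4 := hne0 _ h2'
      have f1 : (p x).1 * (p x').2 = (p x').1 * (p x).2 := by
        apply mul_right_cancel₀ (mul_ne_zero n1 n2)
        linear_combination ((p x').2 * a') * e1 - ((p x').1 * a') * e2
      have g1 := hm _ h2
      have g2 := hm _ h2'
      have hxx : x = x' := by
        apply mul_right_cancel₀ (mul_ne_zero n3 n4)
        linear_combination (- ((p x).2 * (p x').2)) * h3 + ((p x).2 * (p x').2) * h3' + ((p x).1 * (p x').2) * g1 - ((p x').1 * (p x).2) * g2 + M * f1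
      subst hxx
      have : a = a' := mul_left_cancel₀ n3 e2
      rw [this]
  have hXΛ : Λ.card ≤ X.card := by
    refine Finset.card_le_card_of_injOn (fun a => a * m l₀) ?_ ?_
    · intro a ha
      exact Finset.mem_coe.2 (Finset.mem_image₂_of_mem
        (Finset.mem_erase.2 ⟨hne0 a ha, hΛA ha⟩) hl₀)
    · intro a _ a' _ h
      exact mul_right_cancel₀ (hm0 _ hl₀) h
  refine ⟨X, hXcard, ?_⟩
  let b : (↥X × ↥Λ) ⊕ ↥Λ → R := Sum.elim (fun p => (p.1 : R) * (p.2 : R)) (fun _ => 0)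
  let c : R → ↥Λ → (↥X × ↥Λ) ⊕ ↥Λ := fun a l =>
    if h : a ∈ A.erase 0 then
      Sum.inl (⟨a * m l, Finset.mem_image₂_of_mem h l.2⟩, l) else Sum.inr l
  have hcount := aux_count A b (AddMonoidHom.mulLeft M) c
    (by
      intro a ha l
      by_cases h : a ∈ A.erase 0
      · simp only [c, h, b, dif_pos, Sum.elim_inl, AddMonoidHom.coe_mulLeft]
        rw [mul_assoc, hm _ l.2, mul_comm]
      · have : a = 0 := by
          by_contra h'
          exact h (Finset.mem_erase.2 ⟨h', ha⟩)
        simp [c, b, this])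
    (by
      intro a ha a' ha' l l' hcc
      by_cases h : a ∈ A.erase 0 <;> by_cases h' : a' ∈ A.erase 0
      · simp only [c, h, h', dif_pos, Sum.inl.injEq, Prod.mk.injEq, Subtype.mk.injEq] at hcc
        obtain ⟨h1, rfl⟩ := hcc
        exact ⟨mul_right_cancel₀ (hm0 _ l.2) h1, rfl⟩
      · simp only [c, dif_pos h, dif_neg h', reduceCtorEq] at hcc
      · simp only [c, dif_pos h', dif_neg h, reduceCtorEq] at hcc
      · simp only [c, dif_neg h, dif_neg h', Sum.inr.injEq] at hcc
        have z : a = 0 := by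
          by_contra z
          exact h (Finset.mem_erase.2 ⟨z, ha⟩)
        have z' : a' = 0 := by
          by_contra z
          exact h' (Finset.mem_erase.2 ⟨z, ha'⟩)
        exact ⟨z.trans z'.symm, hcc⟩) k
  let W1 : Finset R := (Finset.univ : Finset (Fin k ⊕ Fin k → ((↥X × ↥Λ) ⊕ ↥Λ) × Bool)).image
    (fun F => ∑ j, auxSgn b (F j))
  let W2 : Finset R := Finset.image₂ (fun (x : R) (ε : ↥Λ → ℤ) => ∑ l, ε l • (x * (l : R))) X
    (Fintype.piFinset fun _ => Finset.Icc (-1) 1)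
  obtain ⟨Ψ, _, _, e, hn, hW⟩ := aux_mean (W1 ∪ W2)
  have hlow := aux_lower e hn b (J := Fin k ⊕ Fin k) (fun F hF => hW _
    (Finset.mem_union_left _ (Finset.mem_image_of_mem _ (Finset.mem_univ F))) hF)
  have hmom : ∀ x : ↥X, ∑ ψ, (∑ l : ↥Λ, (e ψ ((x : R) * (l : R))).re) ^ (2 * k)
      ≤ Fintype.card Ψ * (12 * k * Λ.card : ℝ) ^ k := by
    intro x
    have := aux_moment e hn (fun l : ↥Λ => (x : R) * (l : R)) (by
      intro ε hε hε0
      refine hW _ (Finset.mem_union_right _ (Finset.mem_image₂_of_mem x.2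
        (Fintype.mem_piFinset.2 fun l => Finset.mem_Icc.2 (abs_le.1 (hε l))))) ?_
      intro hs
      apply hε0
      have h1 : (x : R) * ∑ l : ↥Λ, ε l • (l : R) = 0 := by
        rw [Finset.mul_sum, ← hs]
        exact Finset.sum_congr rfl fun l _ => mul_smul_comm _ _ _
      have h2 := (mul_eq_zero.1 h1).resolve_left (hX0 _ x.2)
      let ε' : R → ℤ := fun y => if h : y ∈ Λ then ε ⟨y, h⟩ else 0
      have h3 : ∀ l : ↥Λ, ε' l = ε l := fun l => by simp [ε']
      have h4 := hdis ε' (by intro y hy; simpa [ε', hy] using hε ⟨y, hy⟩) (by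
        rw [← Finset.sum_coe_sort, ← h2]
        exact Finset.sum_congr rfl fun l _ => by rw [h3])
      funext l
      rw [← h3, h4 _ l.2]
      rfl) k hk
    simpa using this
  have hB : (Λ.card : ℝ) ^ (2 * k) ≤ (Fintype.card ↥X : ℝ) ^ (2 * k) * (12 * k * Λ.card : ℝ) ^ k := by
    have hd1 : (1 : ℝ) ≤ Λ.card := by exact_mod_cast Finset.card_pos.2 ⟨l₀, hl₀⟩
    have hk1 : (1 : ℝ) ≤ k := by exact_mod_cast hk
    have h1 : (1 : ℝ) ≤ (12 * k * Λ.card : ℝ) ^ k := one_le_pow₀ (by nlinarith)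
    have h2 : (Λ.card : ℝ) ^ (2 * k) ≤ (Fintype.card ↥X : ℝ) ^ (2 * k) := by
      rw [Fintype.card_coe]
      gcongr
    calc _ ≤ _ := h2
      _ ≤ _ := le_mul_of_one_le_right (by positivity) h1
  have hj := aux_jensen (fun (x : ↥X) ψ => ∑ l : ↥Λ, (e ψ ((x : R) * (l : R))).re) k hk _ _ hmom hB
  have hsum : ∀ ψ, ∑ i, (e ψ (b i)).re
      = ∑ x : ↥X, ∑ l : ↥Λ, (e ψ ((x : R) * (l : R))).re + Λ.card := by
    intro ψ
    rw [Fintype.sum_sum_type, Fintype.sum_prod_type]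
    simp [b]
  simp_rw [hsum] at hlow
  rw [show Fintype.card (Fin k ⊕ Fin k) = 2 * k by simp [two_mul]] at hlow
  rw [← hlow] at hj
  have hP : (0 : ℝ) < Fintype.card Ψ := Nat.cast_pos.2 Fintype.card_pos
  have hj' := le_of_mul_le_mul_left hj hP
  rw [Fintype.card_coe] at hj' hcount
  refine le_trans ?_ hj'
  exact_mod_cast hcount

theorem stmt13 :
    ∃ C : ℝ, 0 < C ∧
      ∀ (R : Type u) [CommRing R] [NoZeroDivisors R] [DecidableEq R]
        (A : Finset R) (D : ℝ),
        1 ≤ D → ((A * A).card : ℝ) ≤ D * A.card →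
        2 ≤ addDim 1 A →
        ∀ k : ℕ, 1 ≤ k →
          (Tk k A : ℝ) ≤
            (A.card : ℝ) ^ (2 * k) *
              (C * k * D ^ 6 * (Real.logb 2 (addDim 1 A)) ^ 2 / (addDim 1 A : ℝ)) ^ k := by
  refine ⟨768, by norm_num, ?_⟩
  intro R _ _ _ A D hD hA hd k hk
  have hmem : addDim 1 A ∈ {n : ℕ | ∃ Λ : Finset R, Λ ⊆ A ∧ Λ.card = n ∧ IsKDissociated 1 Λ} := by
    apply Nat.sSup_mem
    · exact ⟨0, ∅, by simp, by simp, fun ε _ _ x hx => by simp at hx⟩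
    · refine ⟨A.card, ?_⟩
      rintro n ⟨Λ, h, rfl, -⟩
      exact Finset.card_le_card h
  obtain ⟨Λ, hΛA, hΛ, hdis⟩ := hmem
  rw [← hΛ] at hd ⊢
  obtain ⟨X, hX, hT⟩ := aux_main R A Λ hΛA hdis (Finset.card_pos.1 (by omega)) k hk
  have hd2 : (2 : ℝ) ≤ Λ.card := by exact_mod_cast hd
  have hA2 : 2 ≤ A.card := hd.trans (Finset.card_le_card hΛA)
  have hA2' : (2 : ℝ) ≤ A.card := by exact_mod_cast hA2
  have hE : (A.card : ℝ) ≤ 2 * (A.erase 0).card := by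
    have := Finset.pred_card_le_card_erase (s := A) (a := 0)
    have : A.card ≤ 2 * (A.erase 0).card := by omega
    exact_mod_cast this
  have hX' : (X.card : ℝ) * (A.erase 0).card ≤ ((A * A).card : ℝ) ^ 2 := by exact_mod_cast hX
  have hXb : (X.card : ℝ) ≤ 2 * D ^ 2 * A.card := by
    have h1 : ((A * A).card : ℝ) ^ 2 ≤ (D * A.card) ^ 2 := by gcongr
    have h2 : (X.card : ℝ) * A.card ≤ X.card * (2 * (A.erase 0).card) := by gcongr
    have h3 : (X.card : ℝ) * A.card ≤ (2 * D ^ 2 * A.card) * A.card := by nlinarith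
    exact le_of_mul_le_mul_right h3 (by linarith)
  have hlog : 1 ≤ Real.logb 2 (Λ.card : ℝ) := by
    rw [Real.le_logb_iff_rpow_le (by norm_num) (by linarith)]
    simpa using hd2
  have hdpos : (0 : ℝ) < Λ.card := by linarith
  have hk0 : (0 : ℝ) < k := by exact_mod_cast hk
  have hpos : (0 : ℝ) < (Λ.card : ℝ) ^ (2 * k) := by positivity
  refine le_of_mul_le_mul_right (hT.trans ?_) hpos
  calc (16 : ℝ) ^ k * ((X.card : ℝ) ^ (2 * k) * (12 * k * Λ.card) ^ k)
      ≤ (16 : ℝ) ^ k * ((2 * D ^ 2 * A.card) ^ (2 * k) * (12 * k * Λ.card) ^ k) := by gcongr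
    _ = (A.card : ℝ) ^ (2 * k) * (768 * k * D ^ 4 / Λ.card) ^ k * (Λ.card : ℝ) ^ (2 * k) := by
        rw [pow_mul, pow_mul, pow_mul, ← mul_pow, ← mul_pow, ← mul_pow, ← mul_pow]
        congr 1
        field_simp
        ring
    _ ≤ _ := by
        have h46 : D ^ 4 ≤ D ^ 6 := pow_le_pow_right₀ hD (by norm_num)
        have hl2 : 1 ≤ (Real.logb 2 (Λ.card : ℝ)) ^ 2 := one_le_pow₀ hlog
        have h7 : 768 * (k : ℝ) * D ^ 4 ≤ 768 * k * D ^ 6 * (Real.logb 2 (Λ.card : ℝ)) ^ 2 :=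
          calc 768 * (k : ℝ) * D ^ 4 ≤ 768 * k * D ^ 6 := by gcongr
            _ ≤ _ := le_mul_of_one_le_right (by positivity) hl2
        have h8 := div_le_div_of_nonneg_right h7 hdpos.le
        have h9 : 0 ≤ 768 * (k : ℝ) * D ^ 4 / Λ.card := by positivity
        exact mul_le_mul_of_nonneg_right (mul_le_mul_of_nonneg_left
          (pow_le_pow_left₀ h9 h8 k) (by positivity)) hpos.le
end

section
/- There exist absolute constants c₁ > 0 and c₂ > 0 with the following property. Let C ≥ 1 be a real number, p a prime, and Γ ≤ F_p^* a multiplicative subgroup satisfying φ(|Γ|)·log|Γ| ≥ log p and |Γ| ≤ (log p)^C, where φ is Euler's totient function. Then there is a positive integer n ≤ c₁·log²p/log log p such that |nΓ| ≥ p^{c₂/C}, where nΓ denotes the n-fold additive sumset of Γ inside F_p. -/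
open Finset Pointwise

universe u

section Aux
open Polynomial

lemma aux_irred_dvd {F G : ℤ[X]} (hF : Irreducible F) (z : ℂ)
    (h1 : aeval z F = 0) (h2 : aeval z G = 0) : F ∣ G := by
  have hdeg : F.natDegree ≠ 0 := by
    intro h
    rw [natDegree_eq_zero] at h
    obtain ⟨c, rfl⟩ := h
    simp at h1
    exact hF.ne_zero (by simp [h1])
  have hprim := hF.isPrimitive hdeg
  have hirr := (IsPrimitive.Int.irreducible_iff_irreducible_map_cast hprim).1 hF
  rw [IsPrimitive.Int.dvd_iff_map_cast_dvd_map_cast _ _ hprim]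
  have e1 : aeval z (F.map (Int.castRingHom ℚ)) = 0 := by
    have := aeval_map_algebraMap (A := ℚ) z F
    rw [← h1, ← this]; rfl
  have e2 : aeval z (G.map (Int.castRingHom ℚ)) = 0 := by
    have := aeval_map_algebraMap (A := ℚ) z G
    rw [← h2, ← this]; rfl
  have d1 := minpoly.dvd ℚ z e1
  have d2 := minpoly.dvd ℚ z e2
  have hint : IsIntegral ℚ z := by
    rw [← isAlgebraic_iff_isIntegral]
    exact ⟨_, hirr.ne_zero, e1⟩
  have := (minpoly.irreducible hint).associated_of_dvd hirr d1
  exact this.symm.dvd.trans d2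

lemma aux_mahler_le {F P : ℤ[X]} (hP : P ≠ 0) (hFP : F ∣ P) (A : ℕ) (N : ℕ)
    (hA : P.natDegree ≤ A) (hN : ∑ i ∈ range (A + 1), |P.coeff i| ≤ N) :
    (F.map (Int.castRingHom ℂ)).mahlerMeasure ≤ N := by
  obtain ⟨Q, rfl⟩ := hFP
  have hQ : Q ≠ 0 := right_ne_zero_of_mul hP
  have h1 := one_le_mahlerMeasure_of_ne_zero hQ
  have h2 := mahlerMeasure_le_sum_norm_coeff ((F * Q).map (Int.castRingHom ℂ))
  have h0 := mahlerMeasure_nonneg (F.map (Int.castRingHom ℂ))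
  rw [sum_over_range' _ _ (A + 1) (lt_of_le_of_lt natDegree_map_le (by omega))] at h2
  · have h3 : ∑ i ∈ range (A + 1), ‖((F * Q).map (Int.castRingHom ℂ)).coeff i‖ ≤ (N : ℝ) := by
      have : ((∑ i ∈ range (A + 1), |(F * Q).coeff i| : ℤ) : ℝ) ≤ (N : ℤ) := by exact_mod_cast hN
      push_cast at this
      simpa only [coeff_map, eq_intCast, Complex.norm_intCast] using this
    rw [Polynomial.map_mul, mahlerMeasure_mul] at h2
    rw [← Polynomial.map_mul] at h2
    nlinarith
  · simp

lemma aux_eval_le {P : ℤ[X]} (A : ℕ) (N : ℕ)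
    (hA : P.natDegree ≤ A) (hN : ∑ i ∈ range (A + 1), |P.coeff i| ≤ N) (z : ℂ) :
    ‖aeval z P‖ ≤ N * (max 1 ‖z‖) ^ A := by
  rw [aeval_eq_sum_range' (n := A + 1) (by omega)]
  refine (norm_sum_le _ _).trans ?_
  have : ((∑ i ∈ range (A + 1), |P.coeff i| : ℤ) : ℝ) ≤ (N : ℤ) := by exact_mod_cast hN
  push_cast at this
  calc _ ≤ ∑ i ∈ range (A + 1), |(P.coeff i : ℝ)| * (max 1 ‖z‖) ^ A := by
        refine Finset.sum_le_sum fun i hi => ?_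
        rw [zsmul_eq_mul, norm_mul, norm_pow, Complex.norm_intCast]
        gcongr
        calc ‖z‖ ^ i ≤ (max 1 ‖z‖) ^ i := by gcongr; exact le_max_right _ _
          _ ≤ _ := pow_le_pow_right₀ (le_max_left _ _) (by simp at hi; omega)
    _ ≤ _ := by rw [← Finset.sum_mul]; gcongr

lemma aux_res {p : ℕ} (hp : p.Prime) {F G : ℤ[X]} (hF : Irreducible F) (hdeg : F.natDegree ≠ 0)
    (N m : ℕ) (hM : (F.map (Int.castRingHom ℂ)).mahlerMeasure ≤ N)
    (hGm : G.natDegree ≤ m)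
    (hG : ∀ z : ℂ, ‖aeval z G‖ ≤ N * (max 1 ‖z‖) ^ m)
    (x : ZMod p) (h1 : aeval x F = 0) (h2 : aeval x G = 0)
    (hlt : N ^ (F.natDegree + m) < p) : F ∣ G := by
  have hinj := (Int.castRingHom ℂ).injective_int
  set r := F.resultant G F.natDegree m with hr
  obtain ⟨u, v, -, -, huv⟩ := exists_mul_add_mul_eq_C_resultant F G (m := F.natDegree) (n := m) le_rfl hGm (.inl hdeg)
  have hpr : (p : ℤ) ∣ r := by
    have := congrArg (aeval x) huv
    simp [h1, h2] at this
    rw [← ZMod.intCast_zmod_eq_zero_iff_dvd] 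
    exact this.symm
  have hsp : (F.map (Int.castRingHom ℂ)).Splits := IsAlgClosed.splits _
  have hform := resultant_eq_prod_eval (F.map (Int.castRingHom ℂ)) (G.map (Int.castRingHom ℂ)) m
    (natDegree_map_le.trans hGm) hsp
  rw [natDegree_map_eq_of_injective hinj, resultant_map_map, ← hr] at hform
  have hbound : ‖((r : ℤ) : ℂ)‖ ≤ (N : ℝ) ^ (F.natDegree + m) := by
    have : ((r : ℤ) : ℂ) = (Int.castRingHom ℂ) r := rfl
    rw [this, hform, norm_mul, norm_pow]
    have hprod : ‖((F.map (Int.castRingHom ℂ)).roots.map (G.map (Int.castRingHom ℂ)).eval).prod‖ ≤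
        (N : ℝ) ^ F.natDegree * ((F.map (Int.castRingHom ℂ)).roots.map (fun a ↦ max 1 ‖a‖)).prod ^ m := by
      have hcard : F.natDegree = (F.map (Int.castRingHom ℂ)).roots.card := by
        rw [← hsp.natDegree_eq_card_roots, natDegree_map_eq_of_injective hinj]
      rw [hcard]
      generalize (F.map (Int.castRingHom ℂ)).roots = s
      induction s using Multiset.induction_on with
      | empty => simp
      | cons a s ih =>
        simp only [Multiset.map_cons, Multiset.prod_cons, norm_mul, Multiset.card_cons]
        have ha := hG a
        have : aeval a G = (G.map (Int.castRingHom ℂ)).eval a := by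
          rw [aeval_def, eval₂_eq_eval_map]; rfl
        rw [this] at ha
        calc _ ≤ (N * (max 1 ‖a‖) ^ m) * _ := mul_le_mul ha ih (norm_nonneg _) (by positivity)
          _ = _ := by rw [pow_succ, mul_pow]; ring
    calc _ ≤ ‖(F.map (Int.castRingHom ℂ)).leadingCoeff‖ ^ m * _ :=
          mul_le_mul_of_nonneg_left hprod (by positivity)
      _ = (F.map (Int.castRingHom ℂ)).mahlerMeasure ^ m * (N : ℝ) ^ F.natDegree := by
        rw [mahlerMeasure_eq_leadingCoeff_mul_prod_roots, mul_pow]; ring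
      _ ≤ (N : ℝ) ^ m * (N : ℝ) ^ F.natDegree := by
        gcongr
        exact mahlerMeasure_nonneg _
      _ = _ := by rw [pow_add]; ring
  have hr0 : r = 0 := by
    rw [Complex.norm_intCast] at hbound
    have h3 : |r| < p := by
      have : ((|r| : ℤ) : ℝ) < (p : ℝ) := by
        push_cast
        exact lt_of_le_of_lt hbound (by exact_mod_cast hlt)
      exact_mod_cast this
    exact Int.eq_zero_of_abs_lt_dvd hpr h3
  rw [hr0, map_zero] at hform
  have hlc : (F.map (Int.castRingHom ℂ)).leadingCoeff ≠ 0 := by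
    rw [leadingCoeff_ne_zero, Polynomial.map_ne_zero_iff hinj]; exact hF.ne_zero
  have hz := (mul_eq_zero.1 hform.symm).resolve_left (pow_ne_zero _ hlc)
  rw [Multiset.prod_eq_zero_iff, Multiset.mem_map] at hz
  obtain ⟨z, hz1, hz2⟩ := hz
  rw [mem_roots'] at hz1
  refine aux_irred_dvd hF z ?_ ?_
  · rw [aeval_def, eval₂_eq_eval_map]; exact hz1.2
  · rw [aeval_def, eval₂_eq_eval_map]; exact hz2

lemma aux_factor {R : Type*} [CommRing R] [IsDomain R] [Algebra ℤ R] {P : ℤ[X]} (hP : P ≠ 0) (x : R)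
    (h : aeval x P = 0) : ∃ F : ℤ[X], Irreducible F ∧ F ∣ P ∧ aeval x F = 0 := by
  induction P using WfDvdMonoid.induction_on_irreducible with
  | zero => exact absurd rfl hP
  | unit u hu => 
    exact absurd h (hu.map (aeval x)).ne_zero
  | mul a i ha hi ih =>
    rw [map_mul, mul_eq_zero] at h
    rcases h with h | h
    · exact ⟨i, hi, dvd_mul_right _ _, h⟩
    · obtain ⟨F, h1, h2, h3⟩ := ih ha h
      exact ⟨F, h1, h2.mul_left _, h3⟩

lemma aux_root_of_unity {z : ℂ} (hz : z ≠ 0) (S : Set ℂ) (hS : S.Finite)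
    (h : ∀ t : ℕ, z ^ (2 ^ t) ∈ S) : ∃ e : ℕ, 0 < e ∧ IsPrimitiveRoot z e := by
  have hni : ¬ Function.Injective (fun t : ℕ => z ^ (2 ^ t)) := by
    intro hi
    exact Set.infinite_of_injective_forall_mem hi h hS
  rw [Function.not_injective_iff] at hni
  have key : ∀ s t : ℕ, s < t → z ^ (2 ^ s) = z ^ (2 ^ t) → ∃ e : ℕ, 0 < e ∧ IsPrimitiveRoot z e := by
    intro s t hst he
    have hlt : 2 ^ s < 2 ^ t := Nat.pow_lt_pow_right (by norm_num) hst
    have h1 : z ^ (2 ^ t - 2 ^ s) = 1 := by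
      have : z ^ (2 ^ t - 2 ^ s) * z ^ (2 ^ s) = z ^ (2 ^ s) := by
        rw [← pow_add, Nat.sub_add_cancel hlt.le, he]
      exact mul_eq_right₀ (pow_ne_zero _ hz) |>.1 this
    have hfin : IsOfFinOrder z := isOfFinOrder_iff_pow_eq_one.2 ⟨_, by omega, h1⟩
    exact ⟨orderOf z, hfin.orderOf_pos, IsPrimitiveRoot.orderOf z⟩
  obtain ⟨s, t, he, hne⟩ := hni
  rcases lt_or_gt_of_ne hne with h | h
  · exact key s t h he
  · exact key t s h he.symm

lemma aux_finite (A N : ℕ) : {z : ℂ | ∃ P : ℤ[X], P ≠ 0 ∧ P.natDegree ≤ A ∧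
    ∑ i ∈ range (A + 1), |P.coeff i| ≤ N ∧ aeval z P = 0}.Finite := by
  have hfin : {P : ℤ[X] | P.natDegree ≤ A ∧ ∑ i ∈ range (A + 1), |P.coeff i| ≤ N}.Finite := by
    refine Set.Finite.of_injOn (f := fun P : ℤ[X] => fun i : Fin (A + 1) => P.coeff i)
      (t := Set.Icc (fun _ => -(N : ℤ)) (fun _ => (N : ℤ))) ?_ ?_ (Set.finite_Icc _ _)
    · rintro P ⟨h1, h2⟩
      have : ∀ i : Fin (A + 1), |P.coeff i| ≤ N := fun i =>
        (Finset.single_le_sum (f := fun i => |P.coeff i|) (fun _ _ => abs_nonneg _)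
          (Finset.mem_range.2 i.2)).trans h2
      exact ⟨fun i => (abs_le.1 (this i)).1, fun i => (abs_le.1 (this i)).2⟩
    · rintro P ⟨h1, -⟩ Q ⟨h2, -⟩ he
      ext i
      by_cases hi : i < A + 1
      · exact congrFun he ⟨i, hi⟩
      · rw [coeff_eq_zero_of_natDegree_lt (by omega), coeff_eq_zero_of_natDegree_lt (by omega)]
  refine (hfin.biUnion (t := fun P => {z : ℂ | z ∈ (P.map (Int.castRingHom ℂ)).roots})
    (fun P _ => Multiset.finite_toSet _)).subset ?_
  rintro z ⟨P, h0, h1, h2, h3⟩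
  simp only [Set.mem_iUnion]
  refine ⟨P, ⟨h1, h2⟩, ?_⟩
  rw [Set.mem_ofPred_eq, mem_roots', Polynomial.map_ne_zero_iff (Int.castRingHom ℂ).injective_int]
  refine ⟨h0, ?_⟩
  rw [aeval_def, eval₂_eq_eval_map] at h3
  exact h3

lemma aux_main_s16 {p : ℕ} [hp : Fact p.Prime] (g : ZMod p) (hg0 : g ≠ 0) (A N : ℕ)
    (hA1 : 1 ≤ A) (hA : A < Nat.totient (orderOf g)) (hN : N ^ (3 * A) < p)
    (H : ∀ x : ZMod p, x ∈ Submonoid.powers g → ∃ P : ℤ[X], P ≠ 0 ∧ P.natDegree ≤ A ∧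
      ∑ i ∈ range (A + 1), |P.coeff i| ≤ N ∧ aeval x P = 0) : False := by
  have H' : ∀ t : ℕ, ∃ P : ℤ[X], P ≠ 0 ∧ P.natDegree ≤ A ∧
      ∑ i ∈ range (A + 1), |P.coeff i| ≤ N ∧ aeval (g ^ (2 ^ t)) P = 0 :=
    fun t => H _ ⟨2 ^ t, rfl⟩
  choose P hP0 hPd hPN hPg using H'
  have hcoeff : ∀ i, |(P 0).coeff i| ≤ N := by
    intro i
    by_cases hi : i < A + 1
    · exact (Finset.single_le_sum (f := fun i => |(P 0).coeff i|) (fun _ _ => abs_nonneg _)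
          (Finset.mem_range.2 hi)).trans (hPN 0)
    · rw [coeff_eq_zero_of_natDegree_lt (by have := hPd 0; omega)]; simp
  have hNp : N < p := by
    rcases Nat.eq_zero_or_pos N with h | h
    · rw [h]; exact hp.out.pos
    · exact lt_of_le_of_lt (Nat.le_self_pow (by omega) N) hN
  have hN1 : 1 ≤ N := by
    by_contra h
    have : N = 0 := by omega
    apply hP0 0
    ext i
    have := hcoeff i
    simp_all
  -- the base factor
  have hg0' : aeval g (P 0) = 0 := by simpa using hPg 0
  obtain ⟨F, hFi, hFP, hFg⟩ := aux_factor (hP0 0) g hg0'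
  have hFdeg : F.natDegree ≠ 0 := by
    intro h
    rw [natDegree_eq_zero] at h
    obtain ⟨c, rfl⟩ := h
    have hc : (p : ℤ) ∣ c := by
      rw [← ZMod.intCast_zmod_eq_zero_iff_dvd]
      simpa using hFg
    have hall := C_dvd_iff_dvd_coeff _ _ |>.1 hFP
    apply hP0 0
    ext i
    have h1 : (p : ℤ) ∣ (P 0).coeff i := hc.trans (hall i)
    have h2 := hcoeff i
    rw [coeff_zero]
    exact Int.eq_zero_of_abs_lt_dvd h1 (by omega)
  have hFA : F.natDegree ≤ A := (natDegree_le_of_dvd hFP (hP0 0)).trans (hPd 0)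
  obtain ⟨z, hz⟩ : ∃ z : ℂ, aeval z F = 0 := by
    obtain ⟨z, hz⟩ := IsAlgClosed.exists_root (F.map (Int.castRingHom ℂ)) (by
      rw [degree_map_eq_of_injective (Int.castRingHom ℂ).injective_int]
      intro h
      exact hFdeg (natDegree_eq_of_degree_eq_some h))
    refine ⟨z, ?_⟩
    rw [aeval_def, eval₂_eq_eval_map]; exact hz
  have hz0 : z ≠ 0 := by
    rintro rfl
    have hX : F ∣ X := aux_irred_dvd hFi 0 hz (by simp)
    obtain ⟨Q, hQ⟩ := hX
    have := congrArg (aeval g) hQ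
    rw [map_mul, hFg, zero_mul, aeval_X] at this
    exact hg0 this
  have chain : ∀ t : ℕ, ∃ F : ℤ[X], Irreducible F ∧ F ∣ P t ∧ aeval (g ^ (2 ^ t)) F = 0 ∧
      aeval (z ^ (2 ^ t)) F = 0 := by
    intro t
    induction t with
    | zero => exact ⟨F, hFi, hFP, by simpa using hFg, by simpa using hz⟩
    | succ t ih =>
      obtain ⟨F, hFi, hFP, hFg, hFz⟩ := ih
      have hFdeg : F.natDegree ≠ 0 := by
        intro h
        rw [natDegree_eq_zero] at h
        obtain ⟨c, rfl⟩ := h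
        simp at hFz
        exact hFi.ne_zero (by simp [hFz])
      have hFA : F.natDegree ≤ A := (natDegree_le_of_dvd hFP (hP0 t)).trans (hPd t)
      have hdvd : F ∣ expand ℤ 2 (P (t + 1)) := by
        refine aux_res hp.out hFi hFdeg N (2 * A) (aux_mahler_le (hP0 t) hFP A N (hPd t) (hPN t))
          ?_ ?_ (g ^ 2 ^ t) hFg ?_ ?_
        · rw [natDegree_expand]; have := hPd (t + 1); omega
        · intro w
          rw [expand_aeval]
          refine (aux_eval_le A N (hPd _) (hPN _) _).trans (le_of_eq ?_)
          rw [norm_pow, pow_mul]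
          congr 2
          rcases le_total 1 ‖w‖ with h | h
          · rw [max_eq_right h, max_eq_right (one_le_pow₀ h)]
          · rw [max_eq_left h, max_eq_left (pow_le_one₀ (norm_nonneg _) h), one_pow]
        · rw [expand_aeval, ← pow_mul, ← pow_succ]; exact hPg _
        · exact lt_of_le_of_lt (Nat.pow_le_pow_right hN1 (by omega)) hN
      have hzP : aeval (z ^ 2 ^ (t + 1)) (P (t + 1)) = 0 := by
        rw [pow_succ, pow_mul, ← expand_aeval]
        exact aeval_eq_zero_of_dvd_aeval_eq_zero hdvd hFz
      obtain ⟨K, hKi, hKP, hKz⟩ := aux_factor (hP0 (t + 1)) _ hzP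
      refine ⟨K, hKi, hKP, ?_, hKz⟩
      have hFK : F ∣ expand ℤ 2 K := by
        refine aux_irred_dvd hFi _ hFz ?_
        rw [expand_aeval, ← pow_mul, ← pow_succ]; exact hKz
      rw [pow_succ, pow_mul, ← expand_aeval]
      exact aeval_eq_zero_of_dvd_aeval_eq_zero hFK hFg
  obtain ⟨e, he, hprim⟩ := aux_root_of_unity hz0 _ (aux_finite A N) (fun t => by
    obtain ⟨F, -, hFP, -, hFz⟩ := chain t
    exact ⟨P t, hP0 t, hPd t, hPN t, aeval_eq_zero_of_dvd_aeval_eq_zero hFP hFz⟩)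
  have hzc : aeval z (cyclotomic e ℤ) = 0 := by
    rw [cyclotomic_eq_minpoly hprim he]; exact minpoly.aeval _ _
  have hFc : F ∣ cyclotomic e ℤ := aux_irred_dvd hFi z hz hzc
  have hcF : cyclotomic e ℤ ∣ F := aux_irred_dvd (cyclotomic.irreducible he) z hzc hz
  have hphi : Nat.totient e ≤ A := by
    rw [← natDegree_cyclotomic e ℤ]
    exact (natDegree_le_of_dvd hcF hFi.ne_zero).trans hFA
  have hcg : aeval g (cyclotomic e ℤ) = 0 := aeval_eq_zero_of_dvd_aeval_eq_zero hFc hFg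
  have hord : orderOf g ∣ p - 1 := ZMod.orderOf_dvd_card_sub_one hg0
  have hordle : orderOf g ≤ p - 1 := Nat.le_of_dvd (by have := hp.out.two_le; omega) hord
  have htot : Nat.totient (orderOf g) ≤ orderOf g := Nat.totient_le _
  by_cases hpe : p ∣ e
  · have h1 := Nat.le_of_dvd (Nat.totient_pos.2 he) (Nat.totient_dvd_of_dvd hpe)
    rw [Nat.totient_prime hp.out] at h1
    omega
  · have : NeZero (e : ZMod p) := ⟨by rwa [Ne, ZMod.natCast_eq_zero_iff]⟩
    have : IsRoot (cyclotomic e (ZMod p)) g := by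
      rw [IsRoot.def, ← map_cyclotomic e (algebraMap ℤ (ZMod p)), eval_map_algebraMap]
      exact hcg
    rw [isRoot_cyclotomic_iff] at this
    rw [← this.eq_orderOf] at hA
    omega

end Aux

section Comb
open Polynomial

lemma nFold_add_mem {G : Type*} [AddCommGroup G] [DecidableEq G] (Γ : Finset G) {m n : ℕ} {a b : G}
    (ha : a ∈ nFold Γ m) (hb : b ∈ nFold Γ n) : a + b ∈ nFold Γ (m + n) := by
  induction n generalizing b with
  | zero => simp [nFold] at hb; simpa [hb] using ha
  | succ n ih =>
    rw [nFold, Finset.mem_add] at hb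
    obtain ⟨c, hc, e, he, rfl⟩ := hb
    rw [← add_assoc, ← add_assoc, nFold]
    exact Finset.add_mem_add (ih hc) he

lemma nFold_nsmul_mem {G : Type*} [AddCommGroup G] [DecidableEq G] (Γ : Finset G) {a : G}
    (ha : a ∈ Γ) (n : ℕ) : n • a ∈ nFold Γ n := by
  induction n with
  | zero => simp [nFold]
  | succ n ih => rw [succ_nsmul, nFold]; exact Finset.add_mem_add ih ha

lemma nFold_sum_mem {G ι : Type*} [AddCommGroup G] [DecidableEq G] (Γ : Finset G) (s : Finset ι)
    (c : ι → ℕ) (a : ι → G) (ha : ∀ i, a i ∈ Γ) :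
    ∑ i ∈ s, c i • a i ∈ nFold Γ (∑ i ∈ s, c i) := by
  classical
  induction s using Finset.induction_on with
  | empty => simp [nFold]
  | insert i s hi ih =>
    rw [Finset.sum_insert hi, Finset.sum_insert hi]
    exact nFold_add_mem Γ (nFold_nsmul_mem Γ (ha i) _) ih

lemma aux_comb {p : ℕ} (Γ : Finset (ZMod p)) (k A : ℕ) (x : ZMod p) (hx : ∀ i : ℕ, x ^ i ∈ Γ)
    (hcard : (nFold Γ (k * A)).card < (k + 1) ^ A) :
    ∃ P : ℤ[X], P ≠ 0 ∧ P.natDegree ≤ A ∧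
      ∑ i ∈ range (A + 1), |P.coeff i| ≤ (2 * k * A : ℕ) ∧ aeval x P = 0 := by
  classical
  have hsum : ∀ ε : Fin A → Fin (k + 1), ∑ i, (ε i : ℕ) ≤ k * A := by
    intro ε
    calc ∑ i, (ε i : ℕ) ≤ ∑ i : Fin A, k := Finset.sum_le_sum fun i _ => by have := (ε i).2; omega
      _ = k * A := by simp [mul_comm]
  let f : (Fin A → Fin (k + 1)) → ZMod p := fun ε =>
    ∑ i : Fin A, (ε i : ℕ) • x ^ ((i : ℕ) + 1) + (k * A - ∑ i, (ε i : ℕ)) • (1 : ZMod p)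
  have hf : ∀ ε ∈ (Finset.univ : Finset (Fin A → Fin (k + 1))), f ε ∈ nFold Γ (k * A) := by
    intro ε _
    have h1 := nFold_sum_mem Γ Finset.univ (fun i => (ε i : ℕ)) (fun i : Fin A => x ^ ((i : ℕ) + 1))
      (fun i => hx _)
    have h2 := nFold_nsmul_mem Γ (a := (1 : ZMod p)) (by simpa using hx 0) (k * A - ∑ i, (ε i : ℕ))
    have := nFold_add_mem Γ h1 h2
    rwa [Nat.add_sub_cancel' (hsum ε)] at this
  obtain ⟨ε, -, ε', -, hne, he⟩ := Finset.exists_ne_map_eq_of_card_lt_of_maps_to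
    (s := (Finset.univ : Finset (Fin A → Fin (k + 1)))) (t := nFold Γ (k * A))
    (by simpa using hcard) hf
  set δ : Fin A → ℤ := fun i => (ε i : ℤ) - (ε' i : ℤ) with hδ
  let P : ℤ[X] := ∑ i : Fin A, monomial ((i : ℕ) + 1) (δ i) - C (∑ i, δ i)
  have hc0 : P.coeff 0 = - ∑ i, δ i := by
    simp [P, coeff_monomial]
  have hcs : ∀ j : Fin A, P.coeff ((j : ℕ) + 1) = δ j := by
    intro j
    simp only [P, coeff_sub, coeff_C_succ, sub_zero, finsetSum_coeff, coeff_monomial]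
    simp [Fin.val_inj]
  refine ⟨P, ?_, ?_, ?_, ?_⟩
  · intro h
    apply hne
    ext i
    have := hcs i
    rw [h, coeff_zero] at this
    simp only [hδ] at this
    omega
  · refine (natDegree_sub_le _ _).trans (max_le ?_ (by rw [natDegree_C]; omega))
    refine natDegree_sum_le_of_forall_le _ _ fun i _ => ?_
    exact (natDegree_monomial_le _).trans (by have := i.2; omega)
  · rw [Finset.sum_range_succ', Finset.sum_range, hc0]
    simp only [hcs]
    have h1 : ∑ i, |δ i| ≤ k * A := by
      calc ∑ i, |δ i| ≤ ∑ i : Fin A, (k : ℤ) := Finset.sum_le_sum fun i _ => by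
            have := (ε i).2
            have := (ε' i).2
            rw [abs_le]
            constructor <;> simp only [hδ] <;> omega
        _ = k * A := by simp [mul_comm]
    have h2 : |∑ i, δ i| ≤ ∑ i, |δ i| := Finset.abs_sum_le_sum_abs _ _
    rw [abs_neg]
    push_cast
    linarith
  · have e1 : ∀ η : Fin A → Fin (k + 1), f η =
        ∑ i : Fin A, ((η i : ℕ) : ZMod p) * x ^ ((i : ℕ) + 1) + (k * A - ∑ i, ((η i : ℕ) : ZMod p)) := by
      intro η
      simp only [f, nsmul_eq_mul, mul_one]
      rw [Nat.cast_sub (hsum η)]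
      push_cast
      rfl
    rw [e1, e1] at he
    have : aeval x P = ∑ i : Fin A, (((ε i : ℕ) : ZMod p) - ((ε' i : ℕ) : ZMod p)) * x ^ ((i : ℕ) + 1) -
        ∑ i, (((ε i : ℕ) : ZMod p) - ((ε' i : ℕ) : ZMod p)) := by
      simp [P, aeval_monomial, hδ, sub_mul]
    rw [this]
    simp only [sub_mul, Finset.sum_sub_distrib]
    linear_combination he

lemma aux_gen {p : ℕ} [Fact p.Prime] (Γ : Finset (ZMod p)) (hne : Γ.Nonempty) (h0 : (0 : ZMod p) ∉ Γ)
    (hmul : ∀ x ∈ Γ, ∀ y ∈ Γ, x * y ∈ Γ) :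
    ∃ g : ZMod p, g ≠ 0 ∧ orderOf g = Γ.card ∧ ∀ i : ℕ, g ^ i ∈ Γ := by
  have hpow : ∀ x ∈ Γ, ∀ n : ℕ, 0 < n → x ^ n ∈ Γ := by
    intro x hx n hn
    induction n, hn using Nat.le_induction with
    | base => simpa using hx
    | succ n hn ih => rw [pow_succ]; exact hmul _ ih _ hx
  have hp := (Fact.out : p.Prime)
  have h1 : (1 : ZMod p) ∈ Γ := by
    obtain ⟨x, hx⟩ := hne
    have hx0 : x ≠ 0 := fun h => h0 (h ▸ hx)
    rw [← ZMod.pow_card_sub_one_eq_one hx0]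
    exact hpow x hx _ (by have := hp.two_le; omega)
  have hinv : ∀ x ∈ Γ, x⁻¹ ∈ Γ := by
    intro x hx
    have hx0 : x ≠ 0 := fun h => h0 (h ▸ hx)
    have : x⁻¹ = x ^ (2 * (p - 1) - 1) := by
      apply inv_eq_of_mul_eq_one_right
      rw [← pow_succ', Nat.sub_add_cancel (by have := hp.two_le; omega), mul_comm, pow_mul,
        ZMod.pow_card_sub_one_eq_one hx0, one_pow]
    rw [this]
    exact hpow x hx _ (by have := hp.two_le; omega)
  let S : Subgroup (ZMod p)ˣ :=
    { carrier := {u | (u : ZMod p) ∈ Γ}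
      mul_mem' := fun {a b} ha hb => by
        simp only [Set.mem_ofPred_eq, Units.val_mul] at *
        exact hmul _ ha _ hb
      one_mem' := by simpa using h1
      inv_mem' := fun {a} ha => by
        simp only [Set.mem_ofPred_eq, Units.val_inv_eq_inv_val] at *
        exact hinv _ ha }
  obtain ⟨g, hg⟩ := IsCyclic.exists_generator (α := S)
  have hcard : Nat.card S = Γ.card := by
    rw [← Nat.card_eq_finsetCard Γ]
    refine Nat.card_congr (Equiv.ofBijective (fun u : S => (⟨((u : (ZMod p)ˣ) : ZMod p), u.2⟩ : Γ)) ⟨?_, ?_⟩)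
    · intro a b hab
      ext
      exact congrArg Subtype.val hab
    · rintro ⟨x, hx⟩
      have hx0 : x ≠ 0 := fun h => h0 (h ▸ hx)
      exact ⟨⟨Units.mk0 x hx0, hx⟩, rfl⟩
  refine ⟨((g : (ZMod p)ˣ) : ZMod p), Units.ne_zero _, ?_, ?_⟩
  · rw [orderOf_units, Subgroup.orderOf_coe, orderOf_eq_card_of_forall_mem_zpowers hg, hcard]
  · intro i
    have : (g ^ i).1 ∈ S := (g ^ i).2
    simpa using! this
end Comb

lemma aux_log_le (x : ℝ) (hx : 0 < x) : Real.logb 2 x ≤ x := by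
  have hl2 : 1 / 2 < Real.log 2 := by have := Real.log_two_gt_d9; linarith
  have h3 : Real.log x ≤ x / 2 := by
    have h1 := Real.log_le_sub_one_of_pos (x := x / 2) (by positivity)
    rw [Real.log_div hx.ne' (by norm_num)] at h1
    have := Real.log_two_lt_d9
    linarith
  rw [Real.logb, div_le_iff₀ (by linarith)]
  nlinarith

lemma aux_num (L ℓ : ℝ) (hL : 3 / 2 ≤ L) (hℓ : ℓ = Real.logb 2 L) : 1 / 2 ≤ ℓ ∧ ℓ ≤ L := by
  constructor
  · rw [hℓ, Real.le_logb_iff_rpow_le (by norm_num) (by linarith), ← Real.sqrt_eq_rpow]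
    refine le_trans ?_ hL
    rw [Real.sqrt_le_left (by norm_num)]
    norm_num
  · rw [hℓ]; exact aux_log_le L (by linarith)

set_option maxHeartbeats 2000000 in
theorem stmt16 :
    ∃ c₁ c₂ : ℝ, 0 < c₁ ∧ 0 < c₂ ∧
      ∀ (C : ℝ), 1 ≤ C →
        ∀ (p : ℕ), p.Prime →
          ∀ Γ : Finset (ZMod p),
            Γ.Nonempty → (0 : ZMod p) ∉ Γ →
            (∀ x ∈ Γ, ∀ y ∈ Γ, x * y ∈ Γ) →
            Real.logb 2 p ≤ (Nat.totient Γ.card : ℝ) * Real.logb 2 Γ.card →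
            (Γ.card : ℝ) ≤ (Real.logb 2 p) ^ C →
            ∃ n : ℕ, 1 ≤ n ∧
              (n : ℝ) ≤ c₁ * (Real.logb 2 p) ^ 2 / Real.logb 2 (Real.logb 2 p) ∧
              (p : ℝ) ^ (c₂ / C) ≤ ((nFold Γ n).card : ℝ) := by
  refine ⟨1, 1 / 16, by norm_num, by norm_num, ?_⟩
  intro C hC p hp Γ hne h0 hmul hφ hub
  have hfact : Fact p.Prime := ⟨hp⟩
  obtain ⟨g, hg0, hgord, hgpow⟩ := aux_gen Γ hne h0 hmul
  set d := Γ.card with hd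
  set L := Real.logb 2 p with hLdef
  have hp2 : (2 : ℝ) ≤ p := by exact_mod_cast hp.two_le
  have hL1 : 1 ≤ L := by
    rw [hLdef, Real.le_logb_iff_rpow_le (by norm_num) (by linarith)]; simpa using hp2
  have hd2 : 2 ≤ d := by
    by_contra h
    have hd1 : d = 1 := by have := hne.card_pos; omega
    rw [hd1] at hφ
    simp at hφ
    linarith
  have hp3 : (3 : ℝ) ≤ p := by
    have h1 : orderOf g ≤ p - 1 := Nat.le_of_dvd (by have := hp.two_le; omega)
      (ZMod.orderOf_dvd_card_sub_one hg0)
    have : 3 ≤ p := by omega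
    exact_mod_cast this
  have hL : 3 / 2 ≤ L := by
    rw [hLdef, Real.le_logb_iff_rpow_le (by norm_num) (by linarith)]
    refine le_trans ?_ hp3
    have : ((2 : ℝ) ^ (3 / 2 : ℝ)) ^ 2 ≤ 3 ^ 2 := by
      rw [← Real.rpow_natCast, ← Real.rpow_mul (by norm_num)]
      norm_num
    exact le_of_sq_le_sq this (by norm_num)
  set ℓ := Real.logb 2 L with hℓdef
  obtain ⟨hℓ1, hℓ2⟩ := aux_num L ℓ hL hℓdef
  have hLpow : (2 : ℝ) ^ ℓ = L := Real.rpow_logb (by norm_num) (by norm_num) (by linarith)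
  have hppow : (2 : ℝ) ^ L = p := Real.rpow_logb (by norm_num) (by norm_num) (by linarith)
  have hdR : (2 : ℝ) ≤ d := by exact_mod_cast hd2
  have hCpos : 0 < C := by linarith
  have htarget : (p : ℝ) ^ (1 / 16 / C) = (2 : ℝ) ^ (L / (16 * C)) := by
    rw [← hppow, ← Real.rpow_mul (by norm_num)]
    congr 1
    field_simp
  have hlogd : Real.logb 2 d ≤ C * ℓ := by
    rw [Real.logb_le_iff_le_rpow (by norm_num) (by linarith), mul_comm, Real.rpow_mul (by norm_num),
      hLpow]
    exact hub
  have hlogd0 : 0 < Real.logb 2 d := Real.logb_pos (by norm_num) (by linarith)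
  set y := L / (C * ℓ) with hy
  have hCℓ : 0 < C * ℓ := by positivity
  have hyL : y * (C * ℓ) = L := div_mul_cancel₀ _ hCℓ.ne'
  have hyφ : y ≤ Nat.totient d := by
    rw [hy, div_le_iff₀ hCℓ]
    exact hφ.trans (by gcongr)
  have hypos : 0 < y := by positivity
  have hsq : L ≤ L ^ 2 / ℓ := by
    rw [le_div_iff₀ (by linarith)]; nlinarith
  rcases lt_or_ge y 8 with hy8 | hy8
  · refine ⟨1, le_rfl, ?_, ?_⟩
    · rw [one_mul]; push_cast; linarith
    · have hc : (nFold Γ 1).card = d := by simp [nFold, hd]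
      rw [hc, htarget]
      have hdd : L ≤ (d : ℝ) ^ 2 := by
        have h1 : (Nat.totient d : ℝ) ≤ d := by exact_mod_cast Nat.totient_le d
        have h2 := (aux_log_le d (by linarith))
        nlinarith
      have h3 : L / (16 * C) ≤ ℓ / 2 := by
        rw [div_le_iff₀ (by positivity), ← hyL]
        nlinarith
      calc (2 : ℝ) ^ (L / (16 * C)) ≤ 2 ^ (ℓ / 2) := by
            apply Real.rpow_le_rpow_of_exponent_le (by norm_num) h3
        _ ≤ d := by
          refine le_of_sq_le_sq ?_ (by positivity)
          rw [← Real.rpow_natCast, ← Real.rpow_mul (by norm_num)]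
          rw [show ℓ / 2 * ((2 : ℕ) : ℝ) = ℓ by push_cast; ring, hLpow]
          exact hdd
  · set A := ⌊y / 8⌋₊ with hA
    have hA1 : 1 ≤ A := by
      rw [hA, Nat.one_le_floor_iff]; linarith
    have hAle : (A : ℝ) ≤ y / 8 := Nat.floor_le (by positivity)
    have hAge : y / 16 ≤ A := by
      have h1 := Nat.lt_floor_add_one (y / 8)
      have h2 : (1 : ℝ) ≤ A := by exact_mod_cast hA1
      rw [← hA] at h1
      linarith
    set k := ⌈L⌉₊ with hk
    have hkge : L ≤ k := Nat.le_ceil L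
    have hkle : (k : ℝ) ≤ 2 * L := by
      have := Nat.ceil_lt_add_one (a := L) (by linarith)
      linarith
    have hk1 : 1 ≤ k := by
      have : (1 : ℝ) ≤ k := by linarith
      exact_mod_cast this
    have hAℓ : (A : ℝ) * ℓ ≤ L / 8 := by
      have : y * ℓ ≤ L := by rw [← hyL]; nlinarith [mul_pos hypos (by linarith : 0 < ℓ)]
      have h2 : (A : ℝ) * ℓ ≤ y / 8 * ℓ := mul_le_mul_of_nonneg_right hAle (by linarith)
      linarith
    have hkA : (k : ℝ) * A ≤ L ^ 2 / 4 / ℓ := by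
      rw [le_div_iff₀ (by linarith), mul_assoc]
      have h2 : (k : ℝ) * (A * ℓ) ≤ 2 * L * (L / 8) :=
        mul_le_mul hkle hAℓ (by positivity) (by linarith)
      linarith
    refine ⟨k * A, Nat.mul_pos hk1 hA1, ?_, ?_⟩
    · push_cast
      refine hkA.trans ?_
      rw [one_mul]
      gcongr
      nlinarith
    · have hbig : (2 : ℝ) ^ (L / (16 * C)) ≤ (((k + 1) ^ A : ℕ) : ℝ) := by
        push_cast
        calc (2 : ℝ) ^ (L / (16 * C)) ≤ 2 ^ (ℓ * A) := by
              apply Real.rpow_le_rpow_of_exponent_le (by norm_num)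
              rw [div_le_iff₀ (by positivity), ← hyL]
              nlinarith [mul_le_mul_of_nonneg_right hAge hCℓ.le]
          _ = L ^ A := by rw [Real.rpow_mul (by norm_num), hLpow, Real.rpow_natCast]
          _ ≤ _ := by gcongr; linarith
      rw [htarget]
      refine hbig.trans ?_
      by_contra hcon
      have hlt : (nFold Γ (k * A)).card < (k + 1) ^ A := by
        rw [not_le] at hcon
        exact_mod_cast hcon
      refine aux_main_s16 g hg0 A (2 * k * A) hA1 ?_ ?_ ?_
      · rw [hgord]
        have : (A : ℝ) < Nat.totient d := by linarith
        exact_mod_cast this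
      · have hN : ((2 * k * A : ℕ) : ℝ) ≤ L ^ 2 := by
          push_cast
          have : L ^ 2 / 4 / ℓ ≤ L ^ 2 / 2 := by
            rw [div_le_iff₀ (by linarith)]
            nlinarith [sq_nonneg L]
          linarith
        have : (((2 * k * A : ℕ) : ℝ)) ^ (3 * A) < p := by
          calc _ ≤ (L ^ 2) ^ (3 * A) := by gcongr
            _ = L ^ (6 * A) := by rw [← pow_mul]; congr 1; ring
            _ = 2 ^ (ℓ * (6 * A : ℕ)) := by rw [Real.rpow_mul (by norm_num), hLpow, Real.rpow_natCast]
            _ < 2 ^ L := by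
              apply Real.rpow_lt_rpow_of_exponent_lt (by norm_num)
              push_cast
              nlinarith
            _ = p := hppow
        exact_mod_cast this
      · rintro x ⟨j, rfl⟩
        exact aux_comb Γ k A _ (fun i => by rw [← pow_mul]; exact hgpow _) hlt
end
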